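/- arXiv:2505.02404 — 3 statements merged into one kernel-verified Lean document; each statement's English description precedes it below -/
import Mathlib

section
/- Let 2 ≤ k₁ and 2 ≤ t ≤ min(k₂, d). The Krull dimension of the quotient ring ℂ[X]/I_∅, where I_∅ = I_t(X) + Σ_{j∈[k₂]} I_2(X_{C_j}), equals (t−1)(d + k₂ − t + 1) + k₂(k₁ − 1), which also equals (t−1)(d + k₂) + k₂(k₁−1) − (t−1)². -/
noncomputable section

open MvPolynomial

namespace CI

/-- The column index set `[k₁] × [k₂]`. -/
abbrev Col (k₁ k₂ : ℕ) := Fin k₁ × Fin k₂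

/-- The polynomial ring `ℂ[X]` in the entries of the `d × (k₁k₂)` matrix `X` of
indeterminates `x_{i,(j,ℓ)}`. -/
abbrev MvP (d k₁ k₂ : ℕ) := MvPolynomial (Fin d × Col k₁ k₂) ℂ

/-- The `r × r` minor of `X` with rows `a` and columns `b`. -/
def minorPoly (d k₁ k₂ r : ℕ) (a : Fin r → Fin d) (b : Fin r → Col k₁ k₂) :
    MvP d k₁ k₂ :=
  (Matrix.of fun i j => (X (a i, b j) : MvP d k₁ k₂)).det

/-- `F_r(X_U)`: the set of all `r × r` minors of the submatrix `X_U`. -/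
def minorSet (d k₁ k₂ r : ℕ) (U : Set (Col k₁ k₂)) : Set (MvP d k₁ k₂) :=
  { f | ∃ a : Fin r → Fin d, ∃ b : Fin r → Col k₁ k₂,
      Function.Injective a ∧ Function.Injective b ∧ (∀ i, b i ∈ U) ∧
      f = minorPoly d k₁ k₂ r a b }

/-- `I_r(X_U)`: the ideal generated by the `r × r` minors of `X_U`. -/
def minorIdeal (d k₁ k₂ r : ℕ) (U : Set (Col k₁ k₂)) : Ideal (MvP d k₁ k₂) :=
  Ideal.span (minorSet d k₁ k₂ r U)

/-- The row slice `R_i = {i} × [k₂]`. -/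
def rowSlice (k₁ k₂ : ℕ) (i : Fin k₁) : Set (Col k₁ k₂) := { p | p.1 = i }

/-- The column slice `C_j = [k₁] × {j}`. -/
def colSlice (k₁ k₂ : ℕ) (j : Fin k₂) : Set (Col k₁ k₂) := { p | p.2 = j }

/-- The conditional independence ideal `𝓘_C = Σ_j I_2(X_{C_j}) + Σ_i I_t(X_{R_i})`. -/
def ciIdeal (d k₁ k₂ t : ℕ) : Ideal (MvP d k₁ k₂) :=
  (⨆ j : Fin k₂, minorIdeal d k₁ k₂ 2 (colSlice k₁ k₂ j)) ⊔
    ⨆ i : Fin k₁, minorIdeal d k₁ k₂ t (rowSlice k₁ k₂ i)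

/-- `I_∅ = I_t(X) + Σ_j I_2(X_{C_j})`. -/
def Iempty (d k₁ k₂ t : ℕ) : Ideal (MvP d k₁ k₂) :=
  minorIdeal d k₁ k₂ t Set.univ ⊔
    ⨆ j : Fin k₂, minorIdeal d k₁ k₂ 2 (colSlice k₁ k₂ j)

/-! ### The case `k₁ = 2`: the ideals `I_S` -/

/-- The column slice `C_j` does not meet `S`. -/
def colOK (k₂ : ℕ) (S : Set (Col 2 k₂)) (j : Fin k₂) : Prop := ∀ i : Fin 2, (i, j) ∉ S

/-- `𝒞(S)`: the union of all column slices not meeting `S`. -/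
def CSet (k₂ : ℕ) (S : Set (Col 2 k₂)) : Set (Col 2 k₂) := { p | colOK k₂ S p.2 }

/-- The condition `Z(1,S) ∖ Z(2,S) ≠ ∅` and `Z(2,S) ∖ Z(1,S) ≠ ∅` under which the
`(t-1)`-minors are included in `F_S`. -/
def tCond (k₂ : ℕ) (S : Set (Col 2 k₂)) : Prop :=
  (∃ ℓ, ((0 : Fin 2), ℓ) ∈ S ∧ ((1 : Fin 2), ℓ) ∉ S) ∧
  (∃ ℓ, ((1 : Fin 2), ℓ) ∈ S ∧ ((0 : Fin 2), ℓ) ∉ S)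

/-- The generating set `F_S` of the ideal `I_S` (for `k₁ = 2`). -/
def FSset (d k₂ t : ℕ) (S : Set (Col 2 k₂)) : Set (MvP d 2 k₂) :=
  minorSet d 2 k₂ 1 S ∪
  (⋃ j ∈ { j : Fin k₂ | colOK k₂ S j }, minorSet d 2 k₂ 2 (colSlice 2 k₂ j)) ∪
  (⋃ _ : tCond k₂ S, minorSet d 2 k₂ (t - 1) (CSet k₂ S)) ∪
  minorSet d 2 k₂ t ((rowSlice 2 k₂ 0 \ S) ∪ CSet k₂ S) ∪
  minorSet d 2 k₂ t ((rowSlice 2 k₂ 1 \ S) ∪ CSet k₂ S)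

/-- The ideal `I_S ⊆ ℂ[X]` for `S ⊆ [2] × [k₂]`, generated by `F_S`. -/
def ISIdeal (d k₂ t : ℕ) (S : Set (Col 2 k₂)) : Ideal (MvP d 2 k₂) :=
  Ideal.span (FSset d k₂ t S)

/-- `u = min(|R₁ ∩ S|, |R₂ ∩ S|)`, the first entry of the combinatorial type of `S`. -/
def uOf (k₂ : ℕ) (S : Set (Col 2 k₂)) : ℕ :=
  min ((rowSlice 2 k₂ 0 ∩ S).ncard) ((rowSlice 2 k₂ 1 ∩ S).ncard)

/-- `v = max(|R₁ ∩ S|, |R₂ ∩ S|)`, the second entry of the combinatorial type of `S`. -/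
def vOf (k₂ : ℕ) (S : Set (Col 2 k₂)) : ℕ :=
  max ((rowSlice 2 k₂ 0 ∩ S).ncard) ((rowSlice 2 k₂ 1 ∩ S).ncard)

/-- `S` contains no column slice. -/
def noColumn (k₂ : ℕ) (S : Set (Col 2 k₂)) : Prop :=
  ∀ j : Fin k₂, ¬ colSlice 2 k₂ j ⊆ S

/-- A subset `S ⊆ [2] × [k₂]` is minimal: `S = ∅`, or `S` contains no column slice,
its combinatorial type `(u,v)` satisfies `1 ≤ u ≤ v ≤ k₂ - t + 1`, and `u + v = k₂`
in case `t = 2`. -/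
def minimalSubset (k₂ t : ℕ) (S : Set (Col 2 k₂)) : Prop :=
  S = ∅ ∨ (noColumn k₂ S ∧ 1 ≤ uOf k₂ S ∧ uOf k₂ S ≤ vOf k₂ S ∧
    vOf k₂ S ≤ k₂ - t + 1 ∧ (t = 2 → uOf k₂ S + vOf k₂ S = k₂))

/-! ### Hypergraphs and their closure -/

/-- The hypergraph `H(S)` on `[k₁] × [k₂]`: its hyperedges are (1) the singletons of
elements of `S`; (2) the 2-subsets of a column slice disjoint from `S`; (3) the
`(t-1)`-subsets of `{i,j} × (NZ(i,S) ∩ NZ(j,S))` for distinct rows `i, j` with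
`Z(i,S) ∖ Z(j,S) ≠ ∅` and `Z(j,S) ∖ Z(i,S) ≠ ∅`; (4) the `t`-subsets of a row slice
disjoint from `S`. -/
def HS (k₁ k₂ t : ℕ) (S : Set (Col k₁ k₂)) : Set (Finset (Col k₁ k₂)) :=
  { e | (∃ p ∈ S, e = {p})
      ∨ (e.card = 2 ∧ (∃ j, ∀ p ∈ e, p.2 = j) ∧ ∀ p ∈ e, p ∉ S)
      ∨ (e.card = t - 1 ∧ ∃ i j : Fin k₁, i ≠ j ∧
           (∃ ℓ, (i, ℓ) ∈ S ∧ (j, ℓ) ∉ S) ∧ (∃ ℓ, (j, ℓ) ∈ S ∧ (i, ℓ) ∉ S) ∧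
           ∀ p ∈ e, (p.1 = i ∨ p.1 = j) ∧ (i, p.2) ∉ S ∧ (j, p.2) ∉ S)
      ∨ (e.card = t ∧ (∃ i, ∀ p ∈ e, p.1 = i) ∧ ∀ p ∈ e, p ∉ S) }

/-- The closure of a hypergraph: iterate the rule "if `{a,b}` and `e` (with `a ∈ e`)
are hyperedges, then add `(e ∖ {a}) ∪ {b}`". -/
inductive HClosure {k₁ k₂ : ℕ} (H : Set (Finset (Col k₁ k₂))) :
    Finset (Col k₁ k₂) → Prop
  | base {e : Finset (Col k₁ k₂)} : e ∈ H → HClosure H e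
  | step {e : Finset (Col k₁ k₂)} (a b : Col k₁ k₂) :
      a ∈ e → HClosure H {a, b} → HClosure H e → HClosure H (insert b (e.erase a))

/-- The determinantal ideal of a hypergraph: it is generated by the minors `[A|B]`
with `A ⊆ [d]`, `B` a hyperedge, and `|A| = |B|`. -/
def hypIdeal (d k₁ k₂ : ℕ) (H : Set (Finset (Col k₁ k₂))) : Ideal (MvP d k₁ k₂) :=
  Ideal.span { f | ∃ e ∈ H, ∃ a : Fin e.card → Fin d, ∃ b : Fin e.card → Col k₁ k₂,
      Function.Injective a ∧ Function.Injective b ∧ (∀ i, b i ∈ e) ∧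
      f = minorPoly d k₁ k₂ e.card a b }

/-- The ideal `I_S` associated to the closure of the hypergraph `H(S)`. -/
def ISclosure (d k₁ k₂ t : ℕ) (S : Set (Col k₁ k₂)) : Ideal (MvP d k₁ k₂) :=
  hypIdeal d k₁ k₂ { e | HClosure (HS k₁ k₂ t S) e }

/-! ### The lexicographic monomial order -/

/-- `varLT a b` means the variable `x_a` is *larger* than `x_b` in the variable order
`x_{1,(1,1)} > x_{2,(1,1)} > ⋯ > x_{d,(1,1)} > x_{1,(2,1)} > ⋯ > x_{d,(k₁,k₂)}`,
i.e. `(ℓ, j, i)` precedes `(ℓ', j', i')` lexicographically, where `a = (i, (j, ℓ))`. -/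
def varLT (d k₁ k₂ : ℕ) (a b : Fin d × Col k₁ k₂) : Prop :=
  Prod.Lex (· < ·) (Prod.Lex (· < ·) (· < ·))
    (a.2.2, (a.2.1, a.1)) (b.2.2, (b.2.1, b.1))

/-- `m ≺ m'` in the lexicographic monomial order determined by the variable order:
at the largest variable where the exponents differ, `m` has the smaller exponent. -/
def monLT (d k₁ k₂ : ℕ) (m m' : (Fin d × Col k₁ k₂) →₀ ℕ) : Prop :=
  ∃ v, (∀ w, varLT d k₁ k₂ w v → m w = m' w) ∧ m v < m' v

/-- `m` is the `≺`-leading monomial of `f`. -/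
def IsLeadMon (d k₁ k₂ : ℕ) (f : MvP d k₁ k₂) (m : (Fin d × Col k₁ k₂) →₀ ℕ) : Prop :=
  m ∈ f.support ∧ ∀ m' ∈ f.support, m' = m ∨ monLT d k₁ k₂ m' m

/-- `G` is a Gröbner basis of `I` with respect to the lexicographic order `≺`:
`G` is contained in `I` and for every nonzero `f ∈ I` there is a `g ∈ G` whose
`≺`-leading monomial divides the `≺`-leading monomial of `f`. -/
def IsGB (d k₁ k₂ : ℕ) (G : Set (MvP d k₁ k₂)) (I : Ideal (MvP d k₁ k₂)) : Prop :=
  G ⊆ (I : Set (MvP d k₁ k₂)) ∧ ∀ f ∈ I, f ≠ 0 →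
    ∃ g ∈ G, ∃ mg, IsLeadMon d k₁ k₂ g mg ∧
      ∀ mf, IsLeadMon d k₁ k₂ f mf → ∀ x, mg x ≤ mf x

/-! ### The matrix `D_A` -/

/-- For `A ∈ ℂ^{k₂ × (k₁-1)}`, the `k₂ × (k₁k₂)` matrix `D_A`: its row `r` has entry
`1` in the column indexed by `(1, r)`, entry `A r ℓ` in the column indexed by
`(1+ℓ, r)` for `ℓ ∈ [k₁-1]`, and zeros elsewhere. -/
def DMat (k₁ k₂ : ℕ) (A : Matrix (Fin k₂) (Fin (k₁ - 1)) ℂ) :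
    Matrix (Fin k₂) (Col k₁ k₂) ℂ := fun r c =>
  if c.2 = r then
    (if _h : (c.1 : ℕ) = 0 then 1
     else A r ⟨(c.1 : ℕ) - 1, by have := c.1.isLt; omega⟩)
  else 0

end CI

namespace CI

theorem ringKrullDim_eq_of_isIntegral (R S : Type*) [CommRing R] [CommRing S] [Algebra R S]
    [Algebra.IsIntegral R S] [FaithfulSMul R S] : ringKrullDim S = ringKrullDim R := by
  apply le_antisymm
  · exact Order.krullDim_le_of_strictMono (PrimeSpectrum.comap (algebraMap R S))
      fun I J h => Ideal.IsIntegral.comap_lt_comap (R := R) (I := I.asIdeal) (J := J.asIdeal) h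
  · refine iSup_le fun l => ?_
    obtain ⟨⟨P, hP, hlo⟩⟩ := Ideal.nonempty_primesOver (S := S) (RelSeries.head l).asIdeal
    obtain ⟨L, hL, -⟩ := Ideal.exists_ltSeries_of_hasGoingUp l P
    rw [← hL]
    exact Order.LTSeries.length_le_krullDim L

/-- The Krull dimension of a finitely generated domain over a field is its transcendence degree. -/
theorem ringKrullDim_eq_trdeg (k A : Type*) [Field k] [CommRing A] [IsDomain A] [Algebra k A]
    [Algebra.FiniteType k A] :
    ringKrullDim A = (Cardinal.toNat (Algebra.trdeg k A) : WithBot ℕ∞) := by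
  obtain ⟨s, g, hg, hint⟩ := exists_integral_inj_algHom_of_fg k A
  algebraize [g.toRingHom]
  have : FaithfulSMul (MvPolynomial (Fin s) k) A := (faithfulSMul_iff_algebraMap_injective _ _).2 hg
  have : Algebra.IsIntegral (MvPolynomial (Fin s) k) A := ⟨hint⟩
  have h := lift_trdeg_add_eq k (MvPolynomial (Fin s) k) A
  rw [trdeg_eq_zero (A := A), Cardinal.lift_zero, add_zero, MvPolynomial.trdeg_of_isDomain] at h
  have h' := congrArg Cardinal.toNat h
  simp only [Cardinal.mk_fin, Cardinal.lift_natCast, Cardinal.toNat_natCast,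
    Cardinal.toNat_lift] at h'
  rw [ringKrullDim_eq_of_isIntegral (MvPolynomial (Fin s) k) A, ← h']
  simp

theorem ringKrullDim_le_card (k : Type*) {A : Type*} [Field k] [CommRing A] [IsDomain A]
    [Algebra k A] [Algebra.FiniteType k A] {ι : Type*} (x : ι → A) (S : Finset ι)
    [Algebra.IsAlgebraic (Algebra.adjoin k (x '' S)) A] : ringKrullDim A ≤ S.card := by
  rw [ringKrullDim_eq_trdeg k A]
  have h2 := Cardinal.toNat_le_toNat (Algebra.IsAlgebraic.trdeg_le_cardinalMk k (x '' S))
    (Cardinal.lt_aleph0_of_finite _)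
  have h3 : Cardinal.toNat (Cardinal.mk (x '' (S : Set ι))) ≤ S.card := by
    have := Set.ncard_image_le (f := x) S.finite_toSet
    rwa [Set.ncard_coe_finset] at this
  exact_mod_cast h2.trans h3

theorem card_le_ringKrullDim (k : Type*) {A : Type*} [Field k] [CommRing A] [IsDomain A]
    [Algebra k A] [Algebra.FiniteType k A] {ι : Type*} [Finite ι] {x : ι → A}
    (hx : AlgebraicIndependent k x) : (Nat.card ι : WithBot ℕ∞) ≤ ringKrullDim A := by
  rw [ringKrullDim_eq_trdeg k A]
  have h := Cardinal.toNat_le_toNat hx.lift_cardinalMk_le_trdeg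
    (by simpa using trdeg_lt_aleph0_of_finiteType)
  simp only [Cardinal.toNat_lift] at h
  exact_mod_cast h

theorem det_mul_eq_zero_of_lt {K : Type*} [Field K] {t r : ℕ} (h : r < t)
    (P : Matrix (Fin t) (Fin r) K) (Q : Matrix (Fin r) (Fin t) K) : (P * Q).det = 0 := by
  by_contra hne
  have h1 := Matrix.rank_of_isUnit (P * Q) ((Matrix.isUnit_iff_isUnit_det _).2 (Ne.isUnit hne))
  have h2 := (Matrix.rank_mul_le_left P Q).trans P.rank_le_width
  simp at h1
  omega

theorem det_mem_subring {A : Type*} [CommRing A] (C : Subring A) {n : ℕ}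
    (M : Matrix (Fin n) (Fin n) A) (h : ∀ i j, M i j ∈ C) : M.det ∈ C := by
  have : M = C.subtype.mapMatrix (Matrix.of fun i j => (⟨M i j, h i j⟩ : C)) := by
    ext i j; rfl
  rw [this, ← RingHom.map_det]
  exact SetLike.coe_mem _

/-- If a minor of maximal size is nonzero, then the entries in its rows and columns determine all
the other entries. -/
theorem mem_subring_of_minor_ne_zero {A m n : Type*} [CommRing A] (C : Subring A)
    (hC : ∀ y z, y ≠ 0 → y ∈ C → y * z ∈ C → z ∈ C) (M : Matrix m n A) {r : ℕ}
    (a : Fin r → m) (b : Fin r → n) (hne : (M.submatrix a b).det ≠ 0)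
    (hmax : ∀ (a' : Fin (r + 1) → m) (b' : Fin (r + 1) → n), (M.submatrix a' b').det = 0)
    (hrow : ∀ s j, M (a s) j ∈ C) (hcol : ∀ i s, M i (b s) ∈ C) (i : m) (j : n) : M i j ∈ C := by
  refine hC _ _ hne (det_mem_subring C _ fun s s' => hrow _ _) ?_
  have h := hmax (Fin.snoc a i) (Fin.snoc b j)
  rw [Matrix.det_succ_row _ (Fin.last r), Fin.sum_univ_castSucc] at h
  have hlast : (-1 : A) ^ ((Fin.last r : ℕ) + (Fin.last r : ℕ)) = 1 := by
    rw [← two_mul, pow_mul]; simp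
  have hsub : (M.submatrix (Fin.snoc a i : Fin (r + 1) → m)
      (Fin.snoc b j : Fin (r + 1) → n)).submatrix
      (Fin.last r).succAbove (Fin.last r).succAbove = M.submatrix a b := by
    ext p q; simp
  rw [hlast, hsub] at h
  simp only [Matrix.submatrix_apply, Fin.snoc_last, one_mul] at h
  rw [mul_comm, eq_neg_of_add_eq_zero_right h]
  refine C.neg_mem (C.sum_mem fun q _ => C.mul_mem
    (C.mul_mem (C.pow_mem (C.neg_mem C.one_mem) _) ?_) (det_mem_subring C _ fun p p' => ?_))
  · simpa using hcol i q
  · simpa using hrow p _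

/-- A matrix whose `t`-minors vanish has a nonzero minor of some size `r < t` all of whose
borderings vanish. -/
theorem exists_maximal_minor {A m n : Type*} [CommRing A] [Nontrivial A] (M : Matrix m n A)
    {t : ℕ} (h : ∀ (a : Fin t → m) (b : Fin t → n), (M.submatrix a b).det = 0) :
    ∃ r < t, ∃ (a : Fin r → m) (b : Fin r → n), (M.submatrix a b).det ≠ 0 ∧
      ∀ (a' : Fin (r + 1) → m) (b' : Fin (r + 1) → n), (M.submatrix a' b').det = 0 := by
  induction t with
  | zero => exact absurd (h finZeroElim finZeroElim) (by simp)
  | succ t ih =>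
    by_cases h' : ∀ (a : Fin t → m) (b : Fin t → n), (M.submatrix a b).det = 0
    · obtain ⟨r, hr, H⟩ := ih h'
      exact ⟨r, by omega, H⟩
    · push Not at h'
      obtain ⟨a, b, hab⟩ := h'
      exact ⟨t, by omega, a, b, hab, h⟩

theorem injective_of_det_submatrix_ne_zero {A m n : Type*} [CommRing A] (M : Matrix m n A)
    {r : ℕ} {a : Fin r → m} {b : Fin r → n} (h : (M.submatrix a b).det ≠ 0) :
    Function.Injective a ∧ Function.Injective b := by
  constructor
  · intro p q hpq
    by_contra hne
    exact h (Matrix.det_zero_of_row_eq hne (by ext; simp [hpq]))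
  · intro p q hpq
    by_contra hne
    exact h (Matrix.det_zero_of_column_eq hne (by simp [hpq]))

/-- The positions `(i, (j, ℓ))` of a set of entries that generically determine the others. -/
def freeSet {d k₁ k₂ : ℕ} (I : Finset (Fin d)) (L : Finset (Fin k₂)) (i₀ : Fin k₂ → Fin d)
    (j₀ : Fin k₂ → Fin k₁) : Finset (Fin d × (Fin k₁ × Fin k₂)) :=
  Finset.univ.filter fun p => (p.2.1 ≠ j₀ p.2.2 ∧ p.1 = i₀ p.2.2) ∨
    (p.2.1 = j₀ p.2.2 ∧ (p.1 ∈ I ∨ p.2.2 ∈ L))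

theorem card_freeSet {d k₁ k₂ : ℕ} (I : Finset (Fin d)) (L : Finset (Fin k₂))
    (i₀ : Fin k₂ → Fin d) (j₀ : Fin k₂ → Fin k₁) :
    (freeSet I L i₀ j₀).card = k₂ * (k₁ - 1) + (d * k₂ - (d - I.card) * (k₂ - L.card)) := by
  rw [freeSet, Finset.filter_or, Finset.card_union_of_disjoint]
  · congr 1
    · have : (Finset.univ.sigma fun ℓ : Fin k₂ => Finset.univ.erase (j₀ ℓ)).card
          = k₂ * (k₁ - 1) := by
        simp
      rw [← this]
      refine Finset.card_bij' (fun p _ => ⟨p.2.2, p.2.1⟩) (fun q _ => (i₀ q.1, (q.2, q.1)))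
        ?_ ?_ ?_ ?_
      · simp +contextual
      · simp +contextual
      · rintro ⟨i, j, ℓ⟩ h
        simp at h
        simp [h.2]
      · simp
    · have : ((Iᶜ ×ˢ Lᶜ)ᶜ).card = d * k₂ - (d - I.card) * (k₂ - L.card) := by
        simp [Finset.card_compl]
      rw [← this]
      refine Finset.card_bij' (fun p _ => (p.1, p.2.2)) (fun q _ => (q.1, (j₀ q.2, q.2)))
        ?_ ?_ ?_ ?_
      · rintro ⟨i, j, ℓ⟩ h
        simp at h ⊢
        tauto
      · rintro ⟨i, ℓ⟩ h
        simp at h ⊢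
        tauto
      · rintro ⟨i, j, ℓ⟩ h
        simp at h
        simp [h.1]
      · simp
  · rw [Finset.disjoint_filter]
    tauto

theorem mul_sub_sub_mul_sub {d k r : ℕ} (hd : r ≤ d) (hk : r ≤ k) :
    d * k - (d - r) * (k - r) = r * (d + k - r) := by
  obtain ⟨d, rfl⟩ := Nat.exists_eq_add_of_le hd
  obtain ⟨k, rfl⟩ := Nat.exists_eq_add_of_le hk
  have : r + d + (r + k) - r = r + d + k := by omega
  rw [this, Nat.add_sub_cancel_left, Nat.add_sub_cancel_left, Nat.sub_eq_iff_eq_add]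
  · ring
  · nlinarith

theorem map_minorPoly {d k₁ k₂ r : ℕ} {A : Type*} [CommRing A] [Algebra ℂ A]
    (f : MvP d k₁ k₂ →ₐ[ℂ] A) (a : Fin r → Fin d) (b : Fin r → Col k₁ k₂) :
    f (minorPoly d k₁ k₂ r a b) = (Matrix.of fun p q => f (X (a p, b q))).det := by
  rw [minorPoly, AlgHom.map_det]
  rfl

/-- A homomorphism kills `I_∅` if and only if the image of the generic matrix satisfies the
defining rank conditions. -/
theorem Iempty_le_ker_iff {d k₁ k₂ t : ℕ} {A : Type*} [CommRing A] [Algebra ℂ A]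
    (f : MvP d k₁ k₂ →ₐ[ℂ] A) : Iempty d k₁ k₂ t ≤ RingHom.ker f ↔
      (∀ (a : Fin t → Fin d) (b : Fin t → Col k₁ k₂),
        (Matrix.of fun p q => f (X (a p, b q))).det = 0) ∧
      ∀ i i' j j' ℓ, f (X (i, (j, ℓ))) * f (X (i', (j', ℓ))) =
        f (X (i, (j', ℓ))) * f (X (i', (j, ℓ))) := by
  simp only [Iempty, sup_le_iff, iSup_le_iff, minorIdeal, Ideal.span_le]
  refine and_congr ⟨fun h a b => ?_, ?_⟩ ⟨fun h i i' j j' ℓ => ?_, ?_⟩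
  · by_contra hne
    obtain ⟨ha, hb⟩ := injective_of_det_submatrix_ne_zero
      (Matrix.of fun p (q : Col k₁ k₂) => f (X (p, q))) (a := a) (b := b) hne
    refine hne ?_
    rw [← map_minorPoly]
    exact h ⟨a, b, ha, hb, fun _ => trivial, rfl⟩
  · rintro h _ ⟨a, b, -, -, -, rfl⟩
    exact (map_minorPoly f a b).trans (h a b)
  · by_cases hi : i = i'
    · rw [hi, mul_comm]
    by_cases hj : j = j'
    · rw [hj]
    have := h ℓ (show minorPoly d k₁ k₂ 2 ![i, i'] ![(j, ℓ), (j', ℓ)] ∈ _ from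
      ⟨_, _, by simp [Function.Injective, Fin.forall_fin_two, hi, Ne.symm hi],
        by simp [Function.Injective, Fin.forall_fin_two, hj, Ne.symm hj],
        by simp [Fin.forall_fin_two, colSlice], rfl⟩)
    have h0 := (map_minorPoly f _ _).symm.trans this
    simpa [Matrix.det_fin_two, sub_eq_zero] using h0
  · rintro h ℓ _ ⟨a, b, -, -, hb, rfl⟩
    refine (map_minorPoly f a b).trans ?_
    have hb' : ∀ q, b q = ((b q).1, ℓ) := fun q => Prod.ext rfl (hb q)
    rw [Matrix.det_fin_two, sub_eq_zero]
    simp only [Matrix.of_apply]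
    rw [hb' 0, hb' 1]
    exact h _ _ _ _ _

theorem ringKrullDim_le_of_Iempty_le_ker {d k₁ k₂ t : ℕ} (hk₁ : 0 < k₁) (htk : t ≤ k₂)
    (htd : t ≤ d) {A : Type*} [CommRing A] [IsDomain A] [Algebra ℂ A] (f : MvP d k₁ k₂ →ₐ[ℂ] A)
    (hsurj : Function.Surjective f) (hf : Iempty d k₁ k₂ t ≤ RingHom.ker f) :
    ringKrullDim A ≤
      ((k₂ * (k₁ - 1) + (d * k₂ - (d - (t - 1)) * (k₂ - (t - 1))) : ℕ) : WithBot ℕ∞) := by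
  obtain ⟨hdet, hswap⟩ := (Iempty_le_ker_iff f).1 hf
  set x : Fin d × Col k₁ k₂ → A := fun p => f (X p) with hx
  have hd : 0 < d := by
    rcases Nat.eq_zero_or_pos t with rfl | h
    · exact absurd (hdet finZeroElim finZeroElim) (by simp)
    · omega
  have hex : ∀ ℓ, ∃ i₀ j₀, x (i₀, (j₀, ℓ)) = 0 → ∀ i j, x (i, (j, ℓ)) = 0 := by
    intro ℓ
    by_cases h : ∃ i j, x (i, (j, ℓ)) ≠ 0
    · obtain ⟨i, j, hij⟩ := h
      exact ⟨i, j, fun h => absurd h hij⟩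
    · push Not at h
      exact ⟨⟨0, hd⟩, ⟨0, hk₁⟩, fun _ => h⟩
  choose i₀ j₀ hzero using hex
  let V : Matrix (Fin d) (Fin k₂) A := Matrix.of fun i ℓ => x (i, (j₀ ℓ, ℓ))
  obtain ⟨r, hr, a, b, hne, hmax⟩ := exists_maximal_minor (t := t) V
    fun a b => hdet a fun q => (j₀ (b q), b q)
  obtain ⟨ha, hb⟩ := injective_of_det_submatrix_ne_zero V hne
  let S := freeSet (Finset.univ.image a) (Finset.univ.image b) i₀ j₀
  have : Algebra.FiniteType ℂ A := .of_surjective f hsurj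
  let C : Subalgebra ℂ A :=
    (Subalgebra.algebraicClosure (Algebra.adjoin ℂ (x '' S)) A).restrictScalars ℂ
  have hCmem : ∀ y, y ∈ C ↔ IsAlgebraic (Algebra.adjoin ℂ (x '' S)) y := fun _ => Iff.rfl
  have hC : ∀ y z, y ≠ 0 → y ∈ C → y * z ∈ C → z ∈ C := fun y z hy h h' =>
    IsAlgebraic.of_mul (mem_nonZeroDivisors_of_ne_zero hy) h h'
  have hS : ∀ p ∈ S, x p ∈ C := fun p hp =>
    isAlgebraic_algebraMap (⟨x p, Algebra.subset_adjoin ⟨p, hp, rfl⟩⟩ : Algebra.adjoin ℂ (x '' S))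
  have hV : ∀ i ℓ, V i ℓ ∈ C := mem_subring_of_minor_ne_zero C.toSubring hC V a b hne hmax
    (fun s ℓ => hS _ (by simp [S, freeSet])) (fun i s => hS _ (by simp [S, freeSet]))
  have hall : ∀ p, x p ∈ C := by
    rintro ⟨i, j, ℓ⟩
    by_cases h0 : x (i₀ ℓ, (j₀ ℓ, ℓ)) = 0
    · rw [hzero ℓ h0]
      exact C.zero_mem
    · refine hC _ _ h0 (hV _ _) ?_
      rw [hx, hswap]
      refine C.mul_mem ?_ (hV _ _)
      by_cases hj : j = j₀ ℓ
      · rw [hj]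
        exact hV _ _
      · exact hS _ (by simp [S, freeSet, hj])
  have htop : ∀ y, y ∈ C := by
    intro y
    obtain ⟨p, rfl⟩ := hsurj y
    have hle : Algebra.adjoin ℂ (Set.range X) ≤ C.comap f :=
      Algebra.adjoin_le (by rintro _ ⟨p, rfl⟩; exact hall p)
    rw [MvPolynomial.adjoin_range_X] at hle
    exact hle trivial
  have : Algebra.IsAlgebraic (Algebra.adjoin ℂ (x '' S)) A := ⟨htop⟩
  refine (ringKrullDim_le_card ℂ x S).trans ?_
  rw [card_freeSet, Finset.card_image_of_injective _ ha, Finset.card_image_of_injective _ hb,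
    Finset.card_univ, Fintype.card_fin]
  have : (d - (t - 1)) * (k₂ - (t - 1)) ≤ (d - r) * (k₂ - r) :=
    Nat.mul_le_mul (by omega) (by omega)
  norm_cast
  omega

theorem ringKrullDim_le_of_forall_isPrime {R : Type*} [CommRing R] {N : ℕ}
    (h : ∀ P : Ideal R, P.IsPrime → ringKrullDim (R ⧸ P) ≤ N) : ringKrullDim R ≤ N := by
  rw [ringKrullDim, Order.krullDim_eq_iSup_coheight]
  refine iSup_le fun P => ?_
  rw [Order.coheight_eq_krullDim_Ici]
  have := h P.asIdeal P.isPrime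
  rwa [ringKrullDim_quotient] at this

/-- The rank-`r` matrix with prescribed rows `a` and columns `b`, in case the submatrix on these
is invertible. -/
def completion {K m n : Type*} [Field K] {r : ℕ} (a : Fin r → m) (b : Fin r → n)
    (M : Matrix m n K) : Matrix m n K :=
  M.submatrix id b * (M.submatrix a b)⁻¹ * M.submatrix a id

theorem completion_apply_row {K m n : Type*} [Field K] {r : ℕ} {a : Fin r → m} {b : Fin r → n}
    {M : Matrix m n K} (h : (M.submatrix a b).det ≠ 0) (s : Fin r) (j : n) :
    completion a b M (a s) j = M (a s) j := by
  have : (completion a b M).submatrix a id = M.submatrix a id := by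
    change M.submatrix a b * (M.submatrix a b)⁻¹ * M.submatrix a id = _
    rw [Matrix.mul_nonsing_inv _ (Ne.isUnit h), Matrix.one_mul]
  exact congrFun (congrFun this s) j

theorem completion_apply_col {K m n : Type*} [Field K] {r : ℕ} {a : Fin r → m} {b : Fin r → n}
    {M : Matrix m n K} (h : (M.submatrix a b).det ≠ 0) (i : m) (s : Fin r) :
    completion a b M i (b s) = M i (b s) := by
  have : (completion a b M).submatrix id b = M.submatrix id b := by
    change M.submatrix id b * (M.submatrix a b)⁻¹ * M.submatrix a b = _
    rw [Matrix.mul_assoc, Matrix.nonsing_inv_mul _ (Ne.isUnit h), Matrix.mul_one]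
  exact congrFun (congrFun this i) s

theorem det_completion_eq_zero {K m n p : Type*} [Field K] {r t : ℕ} (hrt : r < t)
    (a : Fin r → m) (b : Fin r → n) (M : Matrix m n K) (a' : Fin t → m) (b' : Fin t → p)
    (π : p → n) (c : p → K) :
    (Matrix.of fun i j => c (b' j) * completion a b M (a' i) (π (b' j))).det = 0 := by
  refine (congrArg Matrix.det ?_).trans (det_mul_eq_zero_of_lt hrt
    (M.submatrix a' b * (M.submatrix a b)⁻¹) (Matrix.of fun s j => c (b' j) * M (a s) (π (b' j))))
  ext i j
  change _ * ∑ s, (M.submatrix a' b * (M.submatrix a b)⁻¹) i s * M (a s) (π (b' j)) =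
    ∑ s, (M.submatrix a' b * (M.submatrix a b)⁻¹) i s * (_ * M (a s) (π (b' j)))
  rw [Finset.mul_sum]
  exact Finset.sum_congr rfl fun s _ => mul_left_comm _ _ _

theorem le_ringKrullDim_quotient_Iempty {d k₁ k₂ t : ℕ} (hk₁ : 0 < k₁) (ht : 2 ≤ t) (htk : t ≤ k₂)
    (htd : t ≤ d) :
    ((k₂ * (k₁ - 1) + (d * k₂ - (d - (t - 1)) * (k₂ - (t - 1))) : ℕ) : WithBot ℕ∞) ≤
      ringKrullDim (MvP d k₁ k₂ ⧸ Iempty d k₁ k₂ t) := by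
  have hd : t - 1 ≤ d := by omega
  have hk : t - 1 ≤ k₂ := by omega
  let a : Fin (t - 1) → Fin d := Fin.castLE hd
  let b : Fin (t - 1) → Fin k₂ := Fin.castLE hk
  have ha : Function.Injective a := Fin.castLE_injective hd
  have hb : Function.Injective b := Fin.castLE_injective hk
  let s₀ : Fin (t - 1) := ⟨0, by omega⟩
  let j₀ : Fin k₁ := ⟨0, hk₁⟩
  let S := freeSet (Finset.univ.image a) (Finset.univ.image b) (fun _ => a s₀) (fun _ => j₀)
  have hScard : S.card = k₂ * (k₁ - 1) + (d * k₂ - (d - (t - 1)) * (k₂ - (t - 1))) := by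
    rw [card_freeSet, Finset.card_image_of_injective _ ha, Finset.card_image_of_injective _ hb,
      Finset.card_univ, Fintype.card_fin]
  let K := FractionRing (MvPolynomial S ℂ)
  let g : Fin d × Col k₁ k₂ → K := fun p =>
    if h : p ∈ S then algebraMap (MvPolynomial S ℂ) K (X ⟨p, h⟩) else 0
  have hg : AlgebraicIndependent ℂ fun p : S => g p := by
    have := (MvPolynomial.algebraicIndependent_X S ℂ).map' (f := IsScalarTower.toAlgHom ℂ _ K)
      (IsFractionRing.injective (MvPolynomial S ℂ) K)
    convert this using 1
    ext p
    simp [g]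
  have hg0 : ∀ p ∈ S, g p ≠ 0 := fun p hp => hg.ne_zero ⟨p, hp⟩
  let M : Matrix (Fin d) (Fin k₂) K := Matrix.of fun i ℓ => g (i, (j₀, ℓ))
  have hrow : ∀ s ℓ, (a s, (j₀, ℓ)) ∈ S := fun s ℓ => by simp [S, freeSet]
  have hcol : ∀ i s, (i, (j₀, b s)) ∈ S := fun i s => by simp [S, freeSet]
  have hfirst : ∀ j ℓ, (a s₀, (j, ℓ)) ∈ S := fun j ℓ => by
    simp [S, freeSet, em']
  have hM : (M.submatrix a b).det ≠ 0 := by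
    let e : Fin (t - 1) × Fin (t - 1) → S := fun q => ⟨(a q.1, (j₀, b q.2)), hrow _ _⟩
    have he : Function.Injective e := fun q q' h => by
      simp only [e, Subtype.mk.injEq, Prod.mk.injEq, true_and] at h
      exact Prod.ext (ha h.1) (hb h.2)
    have hinj : Function.Injective (aeval fun q => g (e q) : MvPolynomial _ ℂ →ₐ[ℂ] K) :=
      hg.comp e he
    have h := (map_ne_zero_iff _ hinj).2
      (Matrix.det_mvPolynomialX_ne_zero (Fin (t - 1)) ℂ)
    rw [AlgHom.map_det] at h
    convert h using 2
    ext p q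
    simp [M, e]
  let y : Fin d × Col k₁ k₂ → K := fun p =>
    g (a s₀, p.2) / g (a s₀, (j₀, p.2.2)) * completion a b M p.1 p.2.2
  have hy : ∀ p ∈ S, y p = g p := by
    rintro ⟨i, j, ℓ⟩ hp
    have h0 := hg0 _ (hfirst j₀ ℓ)
    by_cases hj : j = j₀
    · subst hj
      simp only [y, div_self h0, one_mul]
      simp [S, freeSet] at hp
      rcases hp with ⟨s, rfl⟩ | ⟨s, rfl⟩
      · exact completion_apply_row hM _ _
      · exact completion_apply_col hM _ _
    · simp [S, freeSet, hj] at hp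
      subst hp
      simp only [y, completion_apply_row hM]
      exact div_mul_cancel₀ _ h0
  let φ : MvP d k₁ k₂ →ₐ[ℂ] K := aeval y
  have hker : Iempty d k₁ k₂ t ≤ RingHom.ker φ := by
    rw [Iempty_le_ker_iff]
    refine ⟨fun a' b' => ?_, fun i i' j j' ℓ => ?_⟩
    · simp only [φ, aeval_X]
      exact det_completion_eq_zero (by omega) a b M a' b' Prod.snd
        fun q => g (a s₀, q) / g (a s₀, (j₀, q.2))
    · simp only [φ, aeval_X, y]
      ring
  have hind : AlgebraicIndependent ℂ fun p : S => φ.rangeRestrict (X p.1) := by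
    refine AlgebraicIndependent.of_comp φ.range.val ?_
    convert hg using 2 with p
    exact (aeval_X y p.1).trans (hy p.1 p.2)
  have : Algebra.FiniteType ℂ φ.range := .of_surjective φ.rangeRestrict φ.rangeRestrict_surjective
  have hcard := card_le_ringKrullDim ℂ hind
  rw [Nat.card_eq_fintype_card, Fintype.card_coe, hScard] at hcard
  refine hcard.trans (ringKrullDim_le_of_surjective
    (Ideal.Quotient.lift (Iempty d k₁ k₂ t) (φ.rangeRestrict : MvP d k₁ k₂ →+* φ.range)
      fun p hp => Subtype.ext (hker hp)) ?_)
  exact Ideal.Quotient.lift_surjective_of_surjective _ _ φ.rangeRestrict_surjective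

/-- for `2 ≤ k₁` and `2 ≤ t ≤ min(k₂, d)`, the Krull dimension of
`ℂ[X]/I_∅` equals `(t−1)(d + k₂ − t + 1) + k₂(k₁ − 1)`, which also equals
`(t−1)(d + k₂) + k₂(k₁−1) − (t−1)²`. -/
theorem Iempty_krullDim
    (d k₁ k₂ t : ℕ) (hk₁ : 2 ≤ k₁) (ht : 2 ≤ t) (htk : t ≤ k₂) (htd : t ≤ d) :
    ringKrullDim (MvP d k₁ k₂ ⧸ Iempty d k₁ k₂ t) =
        (((t - 1) * (d + k₂ - t + 1) + k₂ * (k₁ - 1) : ℕ) : WithBot ℕ∞) ∧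
      (t - 1) * (d + k₂ - t + 1) + k₂ * (k₁ - 1) =
        (t - 1) * (d + k₂) + k₂ * (k₁ - 1) - (t - 1) ^ 2 := by
  have hN : k₂ * (k₁ - 1) + (d * k₂ - (d - (t - 1)) * (k₂ - (t - 1))) =
      (t - 1) * (d + k₂ - t + 1) + k₂ * (k₁ - 1) := by
    rw [mul_sub_sub_mul_sub (by omega) (by omega), add_comm,
      show d + k₂ - (t - 1) = d + k₂ - t + 1 by omega]
  refine ⟨le_antisymm ?_ ?_, ?_⟩
  · rw [← hN]
    refine ringKrullDim_le_of_forall_isPrime fun P hP => ?_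
    refine ringKrullDim_le_of_Iempty_le_ker (by omega) htk htd
      ((Ideal.Quotient.mkₐ ℂ P).comp (Ideal.Quotient.mkₐ ℂ (Iempty d k₁ k₂ t)))
      ((Ideal.Quotient.mkₐ_surjective ℂ P).comp (Ideal.Quotient.mkₐ_surjective ℂ _))
      fun p hp => ?_
    have : Ideal.Quotient.mkₐ ℂ (Iempty d k₁ k₂ t) p = 0 := Ideal.Quotient.eq_zero_iff_mem.2 hp
    rw [RingHom.mem_ker, AlgHom.comp_apply, this, map_zero]
  · rw [← hN]
    exact le_ringKrullDim_quotient_Iempty (by omega) ht htk htd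
  · have h : d + k₂ = (d + k₂ - t + 1) + (t - 1) := by omega
    have h' : (t - 1) * (d + k₂) = (t - 1) * (d + k₂ - t + 1) + (t - 1) ^ 2 := by
      rw [sq, ← mul_add, ← h]
    omega

end CI
end
end

section
/- Let d, k₁, k₂, t be integers with k₁ ≥ 2, t ≥ 2, and t − 1 ≤ min(d, k₂). Suppose M, M' ∈ ℂ^{d×(t−1)} and N, N' ∈ ℂ^{(t−1)×k₂} all have rank t−1, every column of N is nonzero, and A, A' ∈ ℂ^{k₂×(k₁−1)} satisfy M·N·D_A = M'·N'·D_{A'}. Then A = A', and there exists a unique invertible matrix C ∈ ℂ^{(t−1)×(t−1)} such that M' = M·C and N' = C⁻¹·N. -/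
noncomputable section

open MvPolynomial

namespace CI

/-- A matrix whose rank is the number of its rows has a right inverse. -/
theorem exists_mul_eq_one_of_rank_eq_card {m n K : Type*} [Fintype m] [DecidableEq m] [Fintype n]
    [Field K] (A : Matrix m n K) (h : A.rank = Fintype.card m) :
    ∃ B : Matrix n m K, A * B = 1 := by
  classical
  refine Matrix.mulVec_surjective_iff_exists_right_inverse.mp ?_
  have hr : LinearMap.range A.mulVecLin = ⊤ :=
    Submodule.eq_top_of_finrank_eq (by simpa [Matrix.rank] using h)
  exact LinearMap.range_eq_top.mp hr

/-- A matrix whose rank is the number of its columns has a left inverse. -/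
theorem exists_mul_eq_one_of_rank_eq_card' {m n K : Type*} [Fintype m] [Fintype n] [DecidableEq n]
    [Field K] (A : Matrix m n K) (h : A.rank = Fintype.card n) :
    ∃ B : Matrix n m K, B * A = 1 := by
  obtain ⟨B, hB⟩ := exists_mul_eq_one_of_rank_eq_card A.transpose (by rw [Matrix.rank_transpose, h])
  exact ⟨B.transpose, by simpa using congrArg Matrix.transpose hB⟩

theorem mul_DMat_apply {d k₁ k₂ : ℕ} (P : Matrix (Fin d) (Fin k₂) ℂ)
    (A : Matrix (Fin k₂) (Fin (k₁ - 1)) ℂ) (i : Fin d) (c : Col k₁ k₂) :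
    (P * DMat k₁ k₂ A) i c = P i c.2 * DMat k₁ k₂ A c.2 c := by
  rw [Matrix.mul_apply]
  refine Finset.sum_eq_single _ (fun r _ hr => ?_) (by simp)
  simp [DMat, hr.symm]

/-- if `M, M', N, N'` all have rank `t − 1`, every column of `N` is
nonzero, and `M·N·D_A = M'·N'·D_{A'}`, then `A = A'` and there is a unique invertible
`C` with `M' = M·C` and `N' = C⁻¹·N`. -/
theorem fiber_uniqueness
    (d k₁ k₂ t : ℕ) (hk₁ : 2 ≤ k₁) (ht : 2 ≤ t) (htd : t - 1 ≤ d) (htk : t - 1 ≤ k₂)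
    (M M' : Matrix (Fin d) (Fin (t - 1)) ℂ) (N N' : Matrix (Fin (t - 1)) (Fin k₂) ℂ)
    (A A' : Matrix (Fin k₂) (Fin (k₁ - 1)) ℂ)
    (hM : M.rank = t - 1) (hM' : M'.rank = t - 1)
    (hN : N.rank = t - 1) (hN' : N'.rank = t - 1)
    (hNcol : ∀ j : Fin k₂, ∃ i, N i j ≠ 0)
    (heq : M * N * DMat k₁ k₂ A = M' * N' * DMat k₁ k₂ A') :
    A = A' ∧ ∃! C : Matrix (Fin (t - 1)) (Fin (t - 1)) ℂ,
      IsUnit C.det ∧ M' = M * C ∧ N' = C⁻¹ * N := by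
  obtain ⟨L, hL⟩ := exists_mul_eq_one_of_rank_eq_card' M (by simpa using hM)
  obtain ⟨R, hR⟩ := exists_mul_eq_one_of_rank_eq_card N (by simpa using hN)
  obtain ⟨R', hR'⟩ := exists_mul_eq_one_of_rank_eq_card N' (by simpa using hN')
  have hcol (i : Fin d) (c : Col k₁ k₂) :
      (M * N) i c.2 * DMat k₁ k₂ A c.2 c = (M' * N') i c.2 * DMat k₁ k₂ A' c.2 c := by
    rw [← mul_DMat_apply, ← mul_DMat_apply, heq]
  have hMN : M * N = M' * N' := by
    ext i j
    simpa [DMat] using hcol i (⟨0, by omega⟩, j)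
  have hNL : L * (M * N) = N := by rw [← Matrix.mul_assoc, hL, Matrix.one_mul]
  have hM'C : M' = M * (N * R') := by
    rw [← Matrix.mul_assoc, hMN, Matrix.mul_assoc, hR', Matrix.mul_one]
  have hNC : N = N * R' * N' := by
    calc N = L * (M * N) := hNL.symm
      _ = L * (M * (N * R') * N') := by rw [hMN, ← hM'C]
      _ = N * R' * N' := by rw [Matrix.mul_assoc M, ← Matrix.mul_assoc L, hL, Matrix.one_mul]
  have hdet : IsUnit (N * R').det :=
    Matrix.isUnit_det_of_right_inverse (B := N' * R) (by rw [← Matrix.mul_assoc, ← hNC, hR])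
  refine ⟨?_, N * R', ⟨hdet, hM'C, ?_⟩, ?_⟩
  · ext j l
    obtain ⟨i, hi⟩ : ∃ i, (M * N) i j ≠ 0 := by
      by_contra! h
      obtain ⟨i, hi⟩ := hNcol j
      apply hi
      rw [← hNL, Matrix.mul_apply]
      simp [h]
    have := hcol i (⟨l + 1, by omega⟩, j)
    rw [← hMN] at this
    simpa [DMat] using mul_left_cancel₀ hi this
  · calc N' = (N * R')⁻¹ * (N * R' * N') := (Matrix.nonsing_inv_mul_cancel_left _ _ hdet).symm
      _ = (N * R')⁻¹ * N := by rw [← hNC]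
  · rintro C ⟨-, hC, -⟩
    rw [← Matrix.one_mul C, ← hL, Matrix.mul_assoc, ← hC, hM'C, ← Matrix.mul_assoc, hL,
      Matrix.one_mul]

end CI
end
end

section
/- Let k₁ = 2, d = t, and 2 ≤ t ≤ k₂. For every minimal nonempty subset S ⊆ [2]×[k₂], the Krull dimension of ℂ[X]/I_S equals exactly t² + (t−1)k₂ − (t−1)² − 1. -/
noncomputable section

open MvPolynomial

/-- Krull dimension is invariant under injective integral extensions. -/
theorem ringKrullDim_eq_of_isIntegral_of_faithfulSMul (R S : Type*) [CommRing R] [CommRing S]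
    [Algebra R S] [Algebra.IsIntegral R S] [FaithfulSMul R S] :
    ringKrullDim S = ringKrullDim R := by
  refine le_antisymm
    (Order.krullDim_le_of_strictMono (PrimeSpectrum.comap (algebraMap R S)) fun I J h =>
      Ideal.IsIntegral.comap_lt_comap h) ?_
  refine iSup_le fun l => ?_
  obtain ⟨Q, hQ, hQl⟩ := (Ideal.nonempty_primesOver (S := S) l.head.asIdeal).some
  obtain ⟨L, hL, -⟩ := Ideal.exists_ltSeries_of_hasGoingUp l Q
  rw [← hL]
  exact Order.LTSeries.length_le_krullDim L

/-- The Krull dimension of an affine domain is its transcendence degree. -/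
theorem exists_ringKrullDim_eq_trdeg (k R : Type) [Field k] [CommRing R] [IsDomain R]
    [Algebra k R] [Algebra.FiniteType k R] :
    ∃ n : ℕ, ringKrullDim R = n ∧ Algebra.trdeg k R = n := by
  obtain ⟨s, g, hg, hint⟩ := exists_integral_inj_algHom_of_fg k R
  let := g.toRingHom.toAlgebra
  have : Algebra.IsIntegral (MvPolynomial (Fin s) k) R := ⟨hint⟩
  have : FaithfulSMul (MvPolynomial (Fin s) k) R :=
    (faithfulSMul_iff_algebraMap_injective _ _).mpr hg
  have : IsScalarTower k (MvPolynomial (Fin s) k) R :=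
    .of_algebraMap_eq fun x => (g.commutes x).symm
  refine ⟨s, ?_, ?_⟩
  · rw [ringKrullDim_eq_of_isIntegral_of_faithfulSMul (MvPolynomial (Fin s) k) R]
    simp
  · rw [← trdeg_add_eq k (MvPolynomial (Fin s) k) (A := R)]
    simp [trdeg_eq_zero]

theorem ringKrullDim_le_of_forall_quotient_prime {R : Type*} [CommRing R] {n : WithBot ℕ∞}
    (h : ∀ Q : Ideal R, Q.IsPrime → ringKrullDim (R ⧸ Q) ≤ n) : ringKrullDim R ≤ n := by
  refine iSup_le fun l => ?_
  refine le_trans ?_ (h l.head.asIdeal l.head.isPrime)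
  rw [ringKrullDim_quotient]
  let L : LTSeries (PrimeSpectrum.zeroLocus (l.head.asIdeal : Set R)) :=
    { length := l.length
      toFun := fun i => ⟨l i, l.head_le i⟩
      step := fun i => l.step i }
  exact Order.LTSeries.length_le_krullDim L

/-- If an affine domain maps injectively to a ring in such a way that its image is contained in
the image of a polynomial ring in `Fintype.card σ` variables, its dimension is at most
`Fintype.card σ`. -/
theorem ringKrullDim_le_card_of_range_le {k R K : Type} [Field k] [CommRing R] [IsDomain R]
    [Algebra k R] [Algebra.FiniteType k R] [CommRing K] [IsDomain K] [Algebra k K] (f : R →ₐ[k] K)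
    (hf : Function.Injective f) {σ : Type} [Fintype σ] (g : MvPolynomial σ k →ₐ[k] K)
    (h : f.range ≤ g.range) : ringKrullDim R ≤ Fintype.card σ := by
  obtain ⟨n, hn, hn'⟩ := exists_ringKrullDim_eq_trdeg k R
  rw [hn]
  have h1 : Algebra.trdeg k R ≤ Algebra.trdeg k g.range :=
    trdeg_le_of_injective ((Subalgebra.inclusion h).comp f.rangeRestrict)
      ((Subalgebra.inclusion_injective h).comp (f.injective_codRestrict _ _ |>.mpr hf))
  have h2 := trdeg_le_of_surjective g.rangeRestrict g.rangeRestrict_surjective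
  rw [hn'] at h1
  have h3 := h1.trans h2
  simp only [MvPolynomial.trdeg_of_isDomain, Cardinal.mk_fintype, Cardinal.lift_natCast,
    Nat.cast_le] at h3
  exact_mod_cast h3

/-- If the polynomial ring in `Fintype.card σ` variables is algebraic over the image of a finitely
generated algebra, the dimension of the latter is at least `Fintype.card σ`. -/
theorem card_le_ringKrullDim_of_isAlgebraic {k R : Type} [Field k] [CommRing R]
    [Algebra k R] [Algebra.FiniteType k R] {σ : Type} [Fintype σ] (f : R →ₐ[k] MvPolynomial σ k)
    (h : ∀ i, IsAlgebraic f.range (MvPolynomial.X i : MvPolynomial σ k)) :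
    (Fintype.card σ : WithBot ℕ∞) ≤ ringKrullDim R := by
  have hsurj := f.rangeRestrict_surjective
  have : Algebra.FiniteType k f.range := .of_surjective f.rangeRestrict hsurj
  obtain ⟨n, hn, hn'⟩ := exists_ringKrullDim_eq_trdeg k f.range
  have halg : Algebra.IsAlgebraic f.range (MvPolynomial σ k) := by
    refine ⟨fun p => ?_⟩
    induction p using MvPolynomial.induction_on with
    | C a =>
      exact isAlgebraic_algebraMap (⟨MvPolynomial.C a, ⟨algebraMap k R a, by simp⟩⟩ : f.range)
    | add p q hp hq => exact hp.add hq
    | mul_X p i hp => exact hp.mul (h i)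
  have := trdeg_add_eq k f.range (A := MvPolynomial σ k)
  rw [trdeg_eq_zero (R := f.range), hn'] at this
  simp only [add_zero, MvPolynomial.trdeg_of_isDomain, Cardinal.mk_fintype, Cardinal.lift_natCast,
    Nat.cast_inj] at this
  rw [← this, ← hn]
  exact ringKrullDim_le_of_surjective (f.rangeRestrict : R →+* f.range) hsurj

theorem param_count_eq {t k w x y r m n : ℕ} (ht : 2 ≤ t) (hk : w + x + y = k) (htk : t ≤ k)
    (hr : r = min w (t - 2)) (hm : r + m = t - 1) (hn : r + n = t - 1) (hmx : m ≤ x) (hny : n ≤ y) :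
    t * (r + m + n) + ((w - r) * r + (x - m) * (r + m) + (y - n) * (r + n)) + w =
      t ^ 2 + (t - 1) * k - (t - 1) ^ 2 - 1 := by
  obtain ⟨w', rfl⟩ : ∃ w', w = r + w' := ⟨w - r, by omega⟩
  obtain ⟨x', rfl⟩ := Nat.exists_eq_add_of_le hmx
  obtain ⟨y', rfl⟩ := Nat.exists_eq_add_of_le hny
  obtain ⟨p, rfl⟩ : ∃ p, t = p + 1 := ⟨t - 1, by omega⟩
  obtain rfl : m = n := by omega
  simp only [add_tsub_cancel_right, add_tsub_cancel_left] at *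
  subst hm hk
  have : (r + m + 1) ^ 2 + (r + m) * (r + w' + (m + x') + (m + y')) - (r + m) ^ 2 - 1 =
    2 * (r + m) + (r + m) * (r + w' + (m + x') + (m + y')) := by
    rw [Nat.sub_sub]
    apply Nat.sub_eq_of_eq_add
    ring
  rw [this]
  rcases (by omega : w' = 0 ∨ m = 1) with rfl | rfl <;> ring

theorem param_count_le {t k w x y r m n : ℕ} (ht : 2 ≤ t) (hk : w + x + y = k)
    (hr : r ≤ w) (hrt : r ≤ t - 2) (hm : r + m ≤ t - 1) (hn : r + n ≤ t - 1) (hmx : m ≤ x)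
    (hny : n ≤ y) :
    t * (r + m + n) + ((w - r) * r + (x - m) * (r + m) + (y - n) * (r + n)) + w ≤
      t ^ 2 + (t - 1) * k - (t - 1) ^ 2 - 1 := by
  obtain ⟨w', rfl⟩ := Nat.exists_eq_add_of_le hr
  obtain ⟨x', rfl⟩ := Nat.exists_eq_add_of_le hmx
  obtain ⟨y', rfl⟩ := Nat.exists_eq_add_of_le hny
  obtain ⟨q, rfl⟩ : ∃ q, t = r + 2 + q := ⟨t - 2 - r, by omega⟩
  obtain ⟨e, he⟩ : ∃ e, m + e = q + 1 := ⟨q + 1 - m, by omega⟩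
  obtain ⟨f, hf⟩ : ∃ f, n + f = q + 1 := ⟨q + 1 - n, by omega⟩
  have h1 : r + 2 + q - 1 = r + q + 1 := by omega
  simp only [add_tsub_cancel_left, h1]
  subst hk
  have : (r + 2 + q) ^ 2 + (r + q + 1) * (r + w' + (m + x') + (n + y')) - (r + q + 1) ^ 2 - 1 =
    2 * (r + q + 1) + (r + q + 1) * (r + w' + (m + x') + (n + y')) := by
    rw [Nat.sub_sub]
    apply Nat.sub_eq_of_eq_add
    ring
  rw [this]
  have key : (r + 2 + q) * (r + m + n) + (w' * r + x' * (r + m) + y' * (r + n)) + (r + w') +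
      ((x' + 1) * e + (y' + 1) * f + w' * q) =
      2 * (r + q + 1) + (r + q + 1) * (r + w' + (m + x') + (n + y')) := by
    zify at he hf ⊢
    linear_combination (x' + 1 : ℤ) * he + (y' + 1 : ℤ) * hf
  exact key ▸ Nat.le_add_right _ _

section Minors

variable {R : Type*} [CommRing R] [IsDomain R]

/-- If the columns of a square matrix are chosen (after restriction to some rows) from the span of
fewer vectors than the size of the matrix, its determinant vanishes. -/
theorem det_eq_zero_of_mem_span_image {ι m : Type*} [DecidableEq ι] (v : ι → m → R) (L : Finset ι)
    {r : ℕ} (hL : L.card < r) (a : Fin r → m) (c : Fin r → m → R)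
    (hc : ∀ j, c j ∈ Submodule.span R (v '' L)) :
    (Matrix.of fun i j => c j (a i)).det = 0 := by
  have hc' := fun j => (Submodule.mem_span_image_finset_iff_exists_fun R).mp (hc j)
  choose f hf using hc'
  let F : Matrix L (Fin r) R := Matrix.of fun l j => f j l
  obtain ⟨u, hu, hu0⟩ : ∃ u : Fin r → R, F.mulVec u = 0 ∧ u ≠ 0 := by
    by_contra! h
    have hinj : Function.Injective F.mulVecLin := by
      rw [← LinearMap.ker_eq_bot, LinearMap.ker_eq_bot']
      exact h
    have := card_le_of_injective R F.mulVecLin hinj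
    simp at this
    omega
  refine Matrix.exists_mulVec_eq_zero_iff.mp ⟨u, hu0, ?_⟩
  ext i
  have h1 : ∀ l, ∑ j, f j l * u j = 0 := congrFun hu
  simp only [Matrix.mulVec, dotProduct, Matrix.of_apply, Pi.zero_apply, ← hf, Finset.sum_apply,
    Pi.smul_apply, smul_eq_mul, Finset.sum_mul]
  rw [Finset.sum_comm]
  refine Finset.sum_eq_zero fun l _ => ?_
  rw [← mul_zero (v l (a i)), ← h1 l, Finset.mul_sum]
  exact Finset.sum_congr rfl fun j _ => by ring

end Minors

/-- Linearly independent vectors have a nonvanishing maximal minor. -/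
theorem exists_det_ne_zero_of_linearIndependent {K m : Type*} [Field K] [Fintype m] {r : ℕ}
    (v : Fin r → m → K) (hv : LinearIndependent K v) :
    ∃ a : Fin r → m, Function.Injective a ∧ (Matrix.of fun i j => v j (a i)).det ≠ 0 := by
  let M : Matrix (Fin r) m K := Matrix.of v
  have h1 : M.rank = r := by simpa using LinearIndependent.rank_matrix (M := M) hv
  have h2 : Module.finrank K (Submodule.span K (Set.range M.col)) = r := by
    rw [← Matrix.rank_eq_finrank_span_cols, h1]
  obtain ⟨κ, a, ha, hspan, hli⟩ := exists_linearIndependent' K M.col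
  have : Finite κ := Finite.of_injective a ha
  have : Fintype κ := Fintype.ofFinite κ
  have h3 : Fintype.card κ = r := by
    rw [← hspan, finrank_span_eq_card hli] at h2
    exact h2
  let e : Fin r ≃ κ := (finCongr h3.symm).trans (Fintype.equivFin κ).symm
  refine ⟨a ∘ e, ha.comp e.injective, ?_⟩
  have h4 : LinearIndependent K (Matrix.of fun i j => v j ((a ∘ e) i)).row :=
    hli.comp e e.injective
  rw [Matrix.linearIndependent_rows_iff_isUnit, Matrix.isUnit_iff_isUnit_det] at h4
  exact h4.ne_zero

theorem card_lt_of_linearIndepOn_of_det_eq_zero {K ι m : Type*} [Field K] [Fintype m]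
    (v : ι → m → K) (s : Finset ι) (hs : LinearIndepOn K v s) {r : ℕ}
    (h : ∀ (a : Fin r → m) (c : Fin r → ι), Function.Injective a →
      Function.Injective c → (∀ i, c i ∈ s) → (Matrix.of fun i j => v (c j) (a i)).det = 0) :
    s.card < r := by
  by_contra! hr
  obtain ⟨s', hs', hcard⟩ := Finset.exists_subset_card_eq hr
  let c : Fin r → ι := fun i => (s'.equivFinOfCardEq hcard).symm i
  have hc : Function.Injective c :=
    Subtype.val_injective.comp (s'.equivFinOfCardEq hcard).symm.injective
  have hcs : ∀ i, c i ∈ s := fun i => hs' (Subtype.coe_prop _)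
  have hli : LinearIndependent K fun i => v (c i) :=
    hs.comp (fun i => ⟨c i, hcs i⟩) fun i j hij => hc (by simpa using hij)
  obtain ⟨a, ha, hdet⟩ := exists_det_ne_zero_of_linearIndependent _ hli
  exact hdet (h a c ha hc hcs)
/-- A partition of the index set of a family of vectors into three classes together with subsets
`base`, `extB` and `extA` of these classes. The vectors indexed by `basis` are thought of as
arbitrary, and the remaining vectors as linear combinations of those indexed by `supp`. -/
structure SpanData (κ : Type) [Fintype κ] [DecidableEq κ] where
  (U B A base extB extA : Finset κ)
  disjoint_U_B : Disjoint U B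
  disjoint_U_A : Disjoint U A
  disjoint_B_A : Disjoint B A
  cover : ∀ j, j ∈ U ∨ j ∈ B ∨ j ∈ A
  base_subset : base ⊆ U
  extB_subset : extB ⊆ B
  extA_subset : extA ⊆ A

namespace SpanData

variable {κ : Type} [Fintype κ] [DecidableEq κ] (D : SpanData κ)

/-- The indices of the arbitrary vectors. -/
def basis : Finset κ := D.base ∪ D.extB ∪ D.extA

/-- The indices of the vectors of which the vector with index `j` is a linear combination. -/
def supp (j : κ) : Finset κ :=
  if j ∈ D.U then D.base else if j ∈ D.B then D.base ∪ D.extB else D.base ∪ D.extA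

/-- The parameters: the entries of the arbitrary vectors, the coefficients of the linear
combinations and a scalar for every index in `U`. -/
abbrev Idx (t : ℕ) : Type :=
  ({j // j ∈ D.basis} × Fin t) ⊕
    ((Σ j : {j // j ∉ D.basis}, {l // l ∈ D.supp j}) ⊕ {j // j ∈ D.U})

theorem supp_of_mem_U {j : κ} (h : j ∈ D.U) : D.supp j = D.base := if_pos h

theorem supp_of_mem_B {j : κ} (h : j ∈ D.B) : D.supp j = D.base ∪ D.extB := by
  rw [supp, if_neg (Finset.disjoint_right.mp D.disjoint_U_B h), if_pos h]

theorem supp_of_mem_A {j : κ} (h : j ∈ D.A) : D.supp j = D.base ∪ D.extA := by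
  rw [supp, if_neg (Finset.disjoint_right.mp D.disjoint_U_A h),
    if_neg (Finset.disjoint_right.mp D.disjoint_B_A h)]

theorem supp_subset_basis (j : κ) : D.supp j ⊆ D.basis := by
  unfold supp basis
  split_ifs <;> grind

theorem mem_supp_of_mem_basis {j : κ} (h : j ∈ D.basis) : j ∈ D.supp j := by
  have h1 : j ∈ D.U → j ∉ D.B := fun h => Finset.disjoint_left.mp D.disjoint_U_B h
  have h2 : j ∈ D.U → j ∉ D.A := fun h => Finset.disjoint_left.mp D.disjoint_U_A h
  have h5 : j ∈ D.B → j ∉ D.A := fun h => Finset.disjoint_left.mp D.disjoint_B_A h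
  have h3 := @D.extB_subset j
  have h4 := @D.extA_subset j
  have h6 := @D.base_subset j
  simp only [basis, Finset.mem_union] at h
  unfold supp
  split_ifs <;> grind

theorem card_basis : D.basis.card = D.base.card + D.extB.card + D.extA.card := by
  have h1 : Disjoint D.base D.extB := D.disjoint_U_B.mono D.base_subset D.extB_subset
  have h2 : Disjoint D.base D.extA := D.disjoint_U_A.mono D.base_subset D.extA_subset
  have h3 : Disjoint D.extB D.extA := D.disjoint_B_A.mono D.extB_subset D.extA_subset
  rw [basis, Finset.card_union_of_disjoint (Finset.disjoint_union_left.mpr ⟨h2, h3⟩),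
    Finset.card_union_of_disjoint h1]

theorem card_base_union_extB : (D.base ∪ D.extB).card = D.base.card + D.extB.card :=
  Finset.card_union_of_disjoint (D.disjoint_U_B.mono D.base_subset D.extB_subset)

theorem card_base_union_extA : (D.base ∪ D.extA).card = D.base.card + D.extA.card :=
  Finset.card_union_of_disjoint (D.disjoint_U_A.mono D.base_subset D.extA_subset)

theorem card_U_add_card_B_add_card_A : D.U.card + D.B.card + D.A.card = Fintype.card κ := by
  rw [← Finset.card_union_of_disjoint D.disjoint_U_B, ← Finset.card_union_of_disjoint
    (Finset.disjoint_union_left.mpr ⟨D.disjoint_U_A, D.disjoint_B_A⟩), ← Finset.card_univ]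
  congr 1
  ext j
  simpa [or_assoc] using D.cover j

theorem card_idx (t : ℕ) : Fintype.card (D.Idx t) =
    t * (D.base.card + D.extB.card + D.extA.card) +
      ((D.U.card - D.base.card) * D.base.card +
        (D.B.card - D.extB.card) * (D.base.card + D.extB.card) +
        (D.A.card - D.extA.card) * (D.base.card + D.extA.card)) + D.U.card := by
  have hcompl : D.basisᶜ = (D.U \ D.base) ∪ (D.B \ D.extB) ∪ (D.A \ D.extA) := by
    ext j
    have h1 : j ∈ D.U → j ∉ D.B := fun h => Finset.disjoint_left.mp D.disjoint_U_B h
    have h2 : j ∈ D.U → j ∉ D.A := fun h => Finset.disjoint_left.mp D.disjoint_U_A h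
    have h5 : j ∈ D.B → j ∉ D.A := fun h => Finset.disjoint_left.mp D.disjoint_B_A h
    have h3 := @D.extB_subset j
    have h4 := @D.extA_subset j
    have h6 := @D.base_subset j
    have h7 := D.cover j
    simp only [basis, Finset.mem_union, Finset.mem_compl, Finset.mem_sdiff]
    tauto
  have hU : ∑ j ∈ D.U \ D.base, (D.supp j).card = (D.U.card - D.base.card) * D.base.card := by
    rw [Finset.sum_const_nat (m := D.base.card), Finset.card_sdiff_of_subset D.base_subset]
    intro j hj
    rw [D.supp_of_mem_U (Finset.mem_sdiff.mp hj).1]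
  have hB : ∑ j ∈ D.B \ D.extB, (D.supp j).card =
      (D.B.card - D.extB.card) * (D.base.card + D.extB.card) := by
    rw [Finset.sum_const_nat (m := D.base.card + D.extB.card),
      Finset.card_sdiff_of_subset D.extB_subset]
    intro j hj
    rw [D.supp_of_mem_B (Finset.mem_sdiff.mp hj).1, card_base_union_extB]
  have hA : ∑ j ∈ D.A \ D.extA, (D.supp j).card =
      (D.A.card - D.extA.card) * (D.base.card + D.extA.card) := by
    rw [Finset.sum_const_nat (m := D.base.card + D.extA.card),
      Finset.card_sdiff_of_subset D.extA_subset]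
    intro j hj
    rw [D.supp_of_mem_A (Finset.mem_sdiff.mp hj).1, card_base_union_extA]
  have hsum : ∑ j : {j // j ∉ D.basis}, (D.supp j).card = ∑ j ∈ D.basisᶜ, (D.supp j).card :=
    (Finset.sum_subtype D.basisᶜ (p := fun j => j ∉ D.basis) (fun j => by simp)
      fun j => (D.supp j).card).symm
  simp only [Fintype.card_sum, Fintype.card_prod, Fintype.card_sigma, Fintype.card_coe,
    Fintype.card_fin, hsum, card_basis]
  rw [hcompl, Finset.sum_union, Finset.sum_union, hU, hB, hA]
  · ring
  · exact D.disjoint_U_B.mono Finset.sdiff_subset Finset.sdiff_subset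
  · exact Finset.disjoint_union_left.mpr
      ⟨D.disjoint_U_A.mono Finset.sdiff_subset Finset.sdiff_subset,
        D.disjoint_B_A.mono Finset.sdiff_subset Finset.sdiff_subset⟩

end SpanData

theorem isAlgebraic_of_mul_mem {A B : Type*} [CommRing A] [CommRing B] [IsDomain B] [Algebra A B]
    [FaithfulSMul A B]
    {c s : A} {x : B} (hc : algebraMap A B c ≠ 0) (h : algebraMap A B c * x = algebraMap A B s) :
    IsAlgebraic A x := by
  refine ⟨Polynomial.C c * Polynomial.X - Polynomial.C s, fun h0 => hc ?_, by simp [h]⟩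
  have := congrArg (Polynomial.coeff · 1) h0
  simp [Polynomial.coeff_C] at this
  simp [this]

namespace SpanData

variable {κ : Type} [Fintype κ] [DecidableEq κ] (D : SpanData κ)

/-- The generic vectors indexed by `basis`. -/
def genVec (t : ℕ) (j : κ) (i : Fin t) : MvPolynomial (D.Idx t) ℂ :=
  if h : j ∈ D.basis then X (.inl (⟨j, h⟩, i)) else 0

/-- The generic family of vectors with the span relations prescribed by `D`. -/
def vec (t : ℕ) (j : κ) (i : Fin t) : MvPolynomial (D.Idx t) ℂ :=
  if h : j ∈ D.basis then X (.inl (⟨j, h⟩, i))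
  else ∑ l : {l // l ∈ D.supp j}, X (.inr (.inl ⟨⟨j, h⟩, l⟩)) * D.genVec t l i

theorem vec_of_mem {t : ℕ} {j : κ} (h : j ∈ D.basis) (i : Fin t) :
    D.vec t j i = X (.inl (⟨j, h⟩, i)) := dif_pos h

theorem vec_of_notMem {t : ℕ} {j : κ} (h : j ∉ D.basis) (i : Fin t) :
    D.vec t j i = ∑ l : {l // l ∈ D.supp j}, X (.inr (.inl ⟨⟨j, h⟩, l⟩)) * D.genVec t l i :=
  dif_neg h

theorem genVec_of_mem {t : ℕ} {j : κ} (h : j ∈ D.basis) (i : Fin t) :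
    D.genVec t j i = X (.inl (⟨j, h⟩, i)) := dif_pos h

theorem vec_mem_span (t : ℕ) (j : κ) :
    D.vec t j ∈ Submodule.span (MvPolynomial (D.Idx t) ℂ) (D.genVec t '' D.supp j) := by
  by_cases h : j ∈ D.basis
  · refine Submodule.subset_span ⟨j, D.mem_supp_of_mem_basis h, ?_⟩
    ext1 i
    rw [D.vec_of_mem h, D.genVec_of_mem h]
  · have : D.vec t j =
        ∑ l : {l // l ∈ D.supp j}, (X (.inr (.inl ⟨⟨j, h⟩, l⟩)) : MvPolynomial (D.Idx t) ℂ) •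
          D.genVec t l := by
      ext1 i
      simp [D.vec_of_notMem h]
    rw [this]
    exact Submodule.sum_mem _ fun l _ =>
      Submodule.smul_mem _ _ (Submodule.subset_span ⟨l, l.2, rfl⟩)

theorem vec_ne_zero {t : ℕ} {j : κ} (hj : (D.supp j).Nonempty) (i : Fin t) : D.vec t j i ≠ 0 := by
  intro h
  have h1 := congrArg (eval fun _ => (1 : ℂ)) h
  have h2 : ∀ l ∈ D.supp j, eval (fun _ => (1 : ℂ)) (D.genVec t l i) = 1 := fun l hl => by
    rw [D.genVec_of_mem (D.supp_subset_basis j hl), eval_X]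
  by_cases hb : j ∈ D.basis
  · simp [D.vec_of_mem hb] at h1
  · have h3 : ∑ l : {l // l ∈ D.supp j}, eval (fun _ => (1 : ℂ)) (D.genVec t l i) = 0 := by
      simpa [D.vec_of_notMem hb] using h1
    rw [Fintype.sum_congr _ (fun _ => 1) fun l : {l // l ∈ D.supp j} => h2 l l.2] at h3
    simp [hj.ne_empty] at h3

theorem isAlgebraic_coeff {t : ℕ} (S : Subalgebra ℂ (MvPolynomial (D.Idx t) ℂ))
    (hS : ∀ j i, D.vec t j i ∈ S) {j : κ} (hj : j ∉ D.basis) (hcard : (D.supp j).card ≤ t)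
    (l : {l // l ∈ D.supp j}) :
    IsAlgebraic S (X (.inr (.inl ⟨⟨j, hj⟩, l⟩)) : MvPolynomial (D.Idx t) ℂ) := by
  obtain ⟨e⟩ : Nonempty ({l // l ∈ D.supp j} ↪ Fin t) :=
    Function.Embedding.nonempty_of_card_le (by simpa using hcard)
  have hgen : ∀ (l : {l // l ∈ D.supp j}) i, D.genVec t l i ∈ S := fun l i => by
    have hl := D.supp_subset_basis j l.2
    rw [D.genVec_of_mem hl, ← D.vec_of_mem hl]
    exact hS _ _
  let G : Matrix {l // l ∈ D.supp j} {l // l ∈ D.supp j} S :=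
    Matrix.of fun i l => ⟨D.genVec t l (e i), hgen _ _⟩
  let w : {l // l ∈ D.supp j} → S := fun i => ⟨D.vec t j (e i), hS _ _⟩
  let N : {l // l ∈ D.supp j} → MvPolynomial (D.Idx t) ℂ := fun l => X (.inr (.inl ⟨⟨j, hj⟩, l⟩))
  let φ : S →+* MvPolynomial (D.Idx t) ℂ := algebraMap _ _
  have hGN : (G.map φ).mulVec N = φ ∘ w := by
    ext1 i
    change ∑ l : {l // l ∈ D.supp j}, D.genVec t l (e i) * N l = D.vec t j (e i)
    rw [D.vec_of_notMem hj]
    exact Finset.sum_congr rfl fun l _ => mul_comm _ _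
  have hdet : φ G.det ≠ 0 := by
    intro h
    let pt : D.Idx t → ℂ := Sum.elim
      (fun p => if ∃ l : {l // l ∈ D.supp j}, e l = p.2 ∧ l.1 = p.1.1 then 1 else 0) 0
    have h1 := congrArg (eval pt) h
    rw [RingHom.map_det, RingHom.map_det, map_zero] at h1
    have : (eval pt).mapMatrix (φ.mapMatrix G) = 1 := by
      ext i l
      change eval pt (D.genVec t l (e i)) = _
      rw [D.genVec_of_mem (D.supp_subset_basis j l.2), eval_X]
      simp only [pt, Sum.elim_inl, Matrix.one_apply]
      refine if_congr ⟨?_, ?_⟩ rfl rfl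
      · rintro ⟨l', h1, h2⟩
        exact (e.injective h1).symm.trans (Subtype.ext h2)
      · rintro rfl
        exact ⟨i, rfl, rfl⟩
    rw [this, Matrix.det_one] at h1
    exact one_ne_zero h1
  refine isAlgebraic_of_mul_mem (A := S) (c := G.det) (s := G.adjugate.mulVec w l) hdet ?_
  have h2 : (G.map φ).det • N = (φ.mapMatrix G.adjugate).mulVec (φ ∘ w) := by
    rw [← hGN, RingHom.map_adjugate, Matrix.mulVec_mulVec]
    change _ = ((G.map φ).adjugate * _).mulVec N
    rw [Matrix.adjugate_mul, Matrix.smul_mulVec, Matrix.one_mulVec]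
  have h3 := congrFun h2 l
  rw [show (φ.mapMatrix G.adjugate).mulVec (φ ∘ w) l = φ (G.adjugate.mulVec w l) from
    (RingHom.map_mulVec φ _ _ _).symm] at h3
  rw [← h3]
  change φ G.det * N l = _
  rw [RingHom.map_det]
  rfl

theorem isAlgebraic_X {t : ℕ} [NeZero t] (S : Subalgebra ℂ (MvPolynomial (D.Idx t) ℂ))
    (hS : ∀ j i, D.vec t j i ∈ S)
    (hS' : ∀ (j : {j // j ∈ D.U}) i, X (.inr (.inr j)) * D.vec t j i ∈ S)
    (hcard : ∀ j, (D.supp j).card ≤ t) (hU : ∀ j ∈ D.U, (D.supp j).Nonempty) (q : D.Idx t) :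
    IsAlgebraic S (X q : MvPolynomial (D.Idx t) ℂ) := by
  rcases q with ⟨j, i⟩ | ⟨j, l⟩ | j
  · have h := hS j i
    rw [D.vec_of_mem j.2] at h
    exact isAlgebraic_algebraMap (⟨_, h⟩ : S)
  · exact D.isAlgebraic_coeff S hS j.2 (hcard j) l
  · refine isAlgebraic_of_mul_mem (A := S) (c := ⟨_, hS j 0⟩) (s := ⟨_, hS' j 0⟩)
      (D.vec_ne_zero (hU j j.2) 0) (mul_comm _ _)

end SpanData

/-- Any family of vectors admits subsets as in `SpanData` satisfying the span relations. -/
theorem SpanData.exists_linearIndepOn {κ K V : Type} [Fintype κ] [DecidableEq κ] [Field K]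
    [AddCommGroup V] [Module K V] (z : κ → V) {U B A : Finset κ} (hUB : Disjoint U B)
    (hUA : Disjoint U A) (hBA : Disjoint B A) (hcover : ∀ j, j ∈ U ∨ j ∈ B ∨ j ∈ A) :
    ∃ D : SpanData κ, D.U = U ∧ D.B = B ∧ D.A = A ∧ LinearIndepOn K z D.base ∧
      LinearIndepOn K z ↑(D.base ∪ D.extB) ∧ LinearIndepOn K z ↑(D.base ∪ D.extA) ∧
      ∀ j, z j ∈ Submodule.span K (z '' D.supp j) := by
  obtain ⟨b, hbU, -, hbspan, hb⟩ := exists_linearIndepOn_extension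
    (linearIndepOn_empty K z) (Set.empty_subset (U : Set κ))
  obtain ⟨b₁, hb₁B, hbb₁, hb₁span, hb₁⟩ := exists_linearIndepOn_extension hb
    (Set.subset_union_left (t := (B : Set κ)))
  obtain ⟨b₂, hb₂A, hbb₂, hb₂span, hb₂⟩ := exists_linearIndepOn_extension hb
    (Set.subset_union_left (t := (A : Set κ)))
  lift b to Finset κ using Set.toFinite _
  lift b₁ to Finset κ using Set.toFinite _
  lift b₂ to Finset κ using Set.toFinite _
  norm_cast at *
  have h₁ : b ∪ b₁ \ b = b₁ := Finset.union_sdiff_of_subset hbb₁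
  have h₂ : b ∪ b₂ \ b = b₂ := Finset.union_sdiff_of_subset hbb₂
  refine ⟨⟨U, B, A, b, b₁ \ b, b₂ \ b, hUB, hUA, hBA, hcover, hbU,
    sdiff_le_iff.mpr hb₁B, sdiff_le_iff.mpr hb₂A⟩, rfl, rfl, rfl, hb,
    (show LinearIndepOn K z ↑(b ∪ b₁ \ b) by rwa [h₁]),
    (show LinearIndepOn K z ↑(b ∪ b₂ \ b) by rwa [h₂]), fun j => ?_⟩
  rcases hcover j with h | h | h
  · rw [SpanData.supp_of_mem_U _ h]
    exact hbspan ⟨j, h, rfl⟩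
  · rw [SpanData.supp_of_mem_B _ h, h₁]
    exact hb₁span ⟨j, Finset.mem_union_right _ h, rfl⟩
  · rw [SpanData.supp_of_mem_A _ h, h₂]
    exact hb₂span ⟨j, Finset.mem_union_right _ h, rfl⟩

/-- Vectors satisfying the span relations of `D` are specializations of the generic ones. -/
theorem SpanData.exists_algHom {κ K : Type} [Fintype κ] [DecidableEq κ] [Field K] [Algebra ℂ K]
    (D : SpanData κ) {t : ℕ} (z : κ → Fin t → K)
    (hz : ∀ j, z j ∈ Submodule.span K (z '' D.supp j)) (y : κ → K) :
    ∃ g : MvPolynomial (D.Idx t) ℂ →ₐ[ℂ] K,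
      (∀ j i, z j i ∈ g.range) ∧ ∀ j ∈ D.U, y j ∈ g.range := by
  choose N hN using fun j => (Submodule.mem_span_image_finset_iff_exists_fun K).mp (hz j)
  let g : MvPolynomial (D.Idx t) ℂ →ₐ[ℂ] K := aeval
    (Sum.elim (fun p => z p.1 p.2) (Sum.elim (fun p => N p.1 p.2) fun j => y j))
  have hmem : ∀ j ∈ D.basis, ∀ i, z j i ∈ g.range := fun j hj i =>
    ⟨X (.inl (⟨j, hj⟩, i)), aeval_X _ _⟩
  refine ⟨g, fun j i => ?_, fun j hj => ⟨X (.inr (.inr ⟨j, hj⟩)), aeval_X _ _⟩⟩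
  by_cases hj : j ∈ D.basis
  · exact hmem j hj i
  · rw [← hN j, Finset.sum_apply]
    refine Subalgebra.sum_mem _ fun l _ => mul_mem ?_ (hmem l (D.supp_subset_basis j l.2) i)
    exact ⟨X (.inr (.inl ⟨⟨j, hj⟩, l⟩)), aeval_X _ _⟩

namespace CI

/-- `D` is compatible with `S` if its three classes consist of the columns not meeting `S`, the
columns meeting `S` in the second row, and the columns meeting `S` in the first row. -/
structure Compatible {k₂ : ℕ} (S : Set (Col 2 k₂)) (D : SpanData (Fin k₂)) : Prop where
  mem_U : ∀ j, j ∈ D.U ↔ colOK k₂ S j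
  mem_B : ∀ j, j ∈ D.B ↔ ((1 : Fin 2), j) ∈ S
  mem_A : ∀ j, j ∈ D.A ↔ ((0 : Fin 2), j) ∈ S

/-- Every generator of `I_S` is killed by a substitution whose columns satisfy the required span
relations. -/
theorem aeval_eq_zero_of_mem_ISIdeal {t k₂ : ℕ} {S : Set (Col 2 k₂)} {D : SpanData (Fin k₂)}
    (hD : Compatible S D) {R : Type*} [CommRing R] [IsDomain R] [Algebra ℂ R]
    (c : Col 2 k₂ → Fin t → R) (v g : Fin k₂ → Fin t → R)
    (hS : ∀ p ∈ S, c p = 0) (hv : ∀ p, c p ∈ Submodule.span R {v p.2})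
    (hg : ∀ p, c p ∈ Submodule.span R (g '' D.supp p.2))
    (h0 : D.base.card < t - 1) (h1 : D.base.card + D.extB.card < t)
    (h2 : D.base.card + D.extA.card < t) {f : MvP t 2 k₂} (hf : f ∈ ISIdeal t k₂ t S) :
    aeval (fun q : Fin t × Col 2 k₂ => c q.2 q.1) f = 0 := by
  suffices ISIdeal t k₂ t S ≤ RingHom.ker (aeval fun q : Fin t × Col 2 k₂ => c q.2 q.1) from
    this hf
  refine Ideal.span_le.mpr ?_
  have key : ∀ (r : ℕ) (a : Fin r → Fin t) (b : Fin r → Col 2 k₂),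
      aeval (fun q : Fin t × Col 2 k₂ => c q.2 q.1) (minorPoly t 2 k₂ r a b) =
        (Matrix.of fun i j => c (b j) (a i)).det := fun r a b => by
    rw [minorPoly, AlgHom.map_det]
    congr 1
    ext i j
    simp
  have hmono : ∀ {p : Col 2 k₂} {L : Finset (Fin k₂)}, D.supp p.2 ⊆ L →
      c p ∈ Submodule.span R (g '' L) := fun {p L} h =>
    Submodule.span_mono (Set.image_mono (by exact_mod_cast h)) (hg p)
  intro f hf
  rw [SetLike.mem_coe, RingHom.mem_ker]
  rcases hf with (((hf | hf) | hf) | hf) | hf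
  · obtain ⟨a, b, -, -, hb, rfl⟩ := hf
    rw [key, Matrix.det_fin_one, Matrix.of_apply, hS _ (hb 0), Pi.zero_apply]
  · simp only [Set.mem_iUnion] at hf
    obtain ⟨j, -, a, b, -, -, hb, rfl⟩ := hf
    rw [key]
    refine det_eq_zero_of_mem_span_image v {j} (by simp) a _ fun i => ?_
    have : (b i).2 = j := hb i
    simpa [this] using hv (b i)
  · simp only [Set.mem_iUnion] at hf
    obtain ⟨-, a, b, -, -, hb, rfl⟩ := hf
    rw [key]
    refine det_eq_zero_of_mem_span_image g D.base h0 a _ fun i => hmono ?_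
    rw [D.supp_of_mem_U ((hD.mem_U _).mpr (hb i))]
  · obtain ⟨a, b, -, -, hb, rfl⟩ := hf
    rw [key]
    refine det_eq_zero_of_mem_span_image g (D.base ∪ D.extB)
      (by rwa [D.card_base_union_extB]) a _ fun i => ?_
    rcases hb i with ⟨h3, h4⟩ | h3
    · rcases D.cover (b i).2 with h | h | h
      · exact hmono (D.supp_of_mem_U h ▸ Finset.subset_union_left)
      · exact hmono (D.supp_of_mem_B h).le
      · exact absurd ((hD.mem_A _).mp h) fun h5 => h4 (by rwa [← show (b i).1 = 0 from h3] at h5)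
    · exact hmono (D.supp_of_mem_U ((hD.mem_U _).mpr h3) ▸ Finset.subset_union_left)
  · obtain ⟨a, b, -, -, hb, rfl⟩ := hf
    rw [key]
    refine det_eq_zero_of_mem_span_image g (D.base ∪ D.extA)
      (by rwa [D.card_base_union_extA]) a _ fun i => ?_
    rcases hb i with ⟨h3, h4⟩ | h3
    · rcases D.cover (b i).2 with h | h | h
      · exact hmono (D.supp_of_mem_U h ▸ Finset.subset_union_left)
      · exact absurd ((hD.mem_B _).mp h) fun h5 => h4 (by rwa [← show (b i).1 = 1 from h3] at h5)
      · exact hmono (D.supp_of_mem_A h).le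
    · exact hmono (D.supp_of_mem_U ((hD.mem_U _).mpr h3) ▸ Finset.subset_union_left)

open Classical in
/-- The columns of the generic matrix with the span relations prescribed by `D`. -/
def genCol {k₂ : ℕ} (t : ℕ) (S : Set (Col 2 k₂)) (D : SpanData (Fin k₂)) (p : Col 2 k₂)
    (i : Fin t) : MvPolynomial (D.Idx t) ℂ :=
  if p ∈ S then 0
  else if h : p.1 = 1 ∧ p.2 ∈ D.U then X (.inr (.inr ⟨p.2, h.2⟩)) * D.vec t p.2 i
  else D.vec t p.2 i

theorem genCol_mem_span {k₂ : ℕ} (t : ℕ) (S : Set (Col 2 k₂)) (D : SpanData (Fin k₂))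
    (p : Col 2 k₂) :
    genCol t S D p ∈ Submodule.span (MvPolynomial (D.Idx t) ℂ) {D.vec t p.2} := by
  rw [Submodule.mem_span_singleton]
  by_cases h1 : p ∈ S
  · exact ⟨0, by ext1 i; simp [genCol, h1]⟩
  by_cases h2 : p.1 = 1 ∧ p.2 ∈ D.U
  · exact ⟨X (.inr (.inr ⟨p.2, h2.2⟩)), by ext1 i; simp [genCol, h1, h2]⟩
  · exact ⟨1, by ext1 i; simp only [genCol, if_neg h1, dif_neg h2, one_smul]⟩

theorem card_idx_le_ringKrullDim {t k₂ : ℕ} {S : Set (Col 2 k₂)} {D : SpanData (Fin k₂)}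
    (hD : Compatible S D) (hS : noColumn k₂ S) (h0 : D.base.card < t - 1)
    (h1 : D.base.card + D.extB.card < t) (h2 : D.base.card + D.extA.card < t)
    (hU : D.U.Nonempty → D.base.Nonempty) :
    (Fintype.card (D.Idx t) : WithBot ℕ∞) ≤ ringKrullDim (MvP t 2 k₂ ⧸ ISIdeal t k₂ t S) := by
  have : NeZero t := ⟨by omega⟩
  let f : (MvP t 2 k₂ ⧸ ISIdeal t k₂ t S) →ₐ[ℂ] MvPolynomial (D.Idx t) ℂ :=
    Ideal.Quotient.liftₐ _ (aeval fun q : Fin t × Col 2 k₂ => genCol t S D q.2 q.1) fun a ha =>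
      aeval_eq_zero_of_mem_ISIdeal hD (genCol t S D) (D.vec t) (D.genVec t)
        (fun p hp => by ext1 i; simp [genCol, hp]) (genCol_mem_span t S D)
        (fun p => Submodule.span_le.mpr (Set.singleton_subset_iff.mpr (D.vec_mem_span t p.2))
          (genCol_mem_span t S D p)) h0 h1 h2 ha
  have hf : ∀ p i, genCol t S D p i ∈ f.range := fun p i =>
    ⟨Ideal.Quotient.mk _ (X (i, p)), aeval_X _ _⟩
  refine card_le_ringKrullDim_of_isAlgebraic f
    (D.isAlgebraic_X f.range (fun j i => ?_) (fun j i => ?_) (fun j => ?_) fun j hj => ?_)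
  · by_cases h : ((0 : Fin 2), j) ∈ S
    · have h3 : ((1 : Fin 2), j) ∉ S := fun h3 => hS j fun p hp => by
        obtain ⟨e, j'⟩ := p
        obtain rfl : j' = j := hp
        fin_cases e
        exacts [h, h3]
      have h4 : j ∉ D.U := fun h4 => (hD.mem_U j).mp h4 0 h
      simpa [genCol, h3, h4] using hf (1, j) i
    · simpa [genCol, h] using hf (0, j) i
  · have h3 : ((1 : Fin 2), j.1) ∉ S := (hD.mem_U j).mp j.2 1
    simpa [genCol, h3] using hf (1, j) i
  · unfold SpanData.supp
    split_ifs
    · omega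
    · exact D.card_base_union_extB ▸ h1.le
    · exact D.card_base_union_extA ▸ h2.le
  · exact D.supp_of_mem_U hj ▸ hU ⟨j, hj⟩

section Partition

variable {k₂ : ℕ} {S : Set (Col 2 k₂)}

open Classical in
/-- The partition of the columns according to how they meet `S`. -/
theorem exists_partition (hS : noColumn k₂ S) : ∃ U B A : Finset (Fin k₂),
    (∀ j, j ∈ U ↔ colOK k₂ S j) ∧ (∀ j, j ∈ B ↔ ((1 : Fin 2), j) ∈ S) ∧
      (∀ j, j ∈ A ↔ ((0 : Fin 2), j) ∈ S) ∧ Disjoint U B ∧ Disjoint U A ∧ Disjoint B A ∧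
      ∀ j, j ∈ U ∨ j ∈ B ∨ j ∈ A := by
  refine ⟨Finset.univ.filter (colOK k₂ S), Finset.univ.filter fun j => ((1 : Fin 2), j) ∈ S,
    Finset.univ.filter fun j => ((0 : Fin 2), j) ∈ S, by simp, by simp, by simp, ?_, ?_, ?_, ?_⟩
  · exact Finset.disjoint_filter.mpr fun j _ h => h 1
  · exact Finset.disjoint_filter.mpr fun j _ h => h 0
  · refine Finset.disjoint_filter.mpr fun j _ h1 h0 => hS j fun p hp => ?_
    obtain ⟨e, j'⟩ := p
    obtain rfl : j' = j := hp
    fin_cases e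
    exacts [h0, h1]
  · intro j
    simp only [Finset.mem_filter_univ, colOK, Fin.forall_fin_two]
    tauto

theorem Compatible.card_A {D : SpanData (Fin k₂)} (hD : Compatible S D) :
    D.A.card = (rowSlice 2 k₂ 0 ∩ S).ncard := by
  rw [← Set.ncard_coe_finset,
    ← Set.ncard_image_of_injective _ (Prod.mk_right_injective (0 : Fin 2))]
  congr 1
  ext ⟨e, j⟩
  simp only [Set.mem_image, SetLike.mem_coe, hD.mem_A, Prod.mk.injEq, rowSlice, Set.mem_inter_iff,
    Set.mem_ofPred_eq]
  constructor
  · rintro ⟨_, h, rfl, rfl⟩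
    exact ⟨rfl, h⟩
  · rintro ⟨rfl, h⟩
    exact ⟨j, h, rfl, rfl⟩

theorem Compatible.card_B {D : SpanData (Fin k₂)} (hD : Compatible S D) :
    D.B.card = (rowSlice 2 k₂ 1 ∩ S).ncard := by
  rw [← Set.ncard_coe_finset,
    ← Set.ncard_image_of_injective _ (Prod.mk_right_injective (1 : Fin 2))]
  congr 1
  ext ⟨e, j⟩
  simp only [Set.mem_image, SetLike.mem_coe, hD.mem_B, Prod.mk.injEq, rowSlice, Set.mem_inter_iff,
    Set.mem_ofPred_eq]
  constructor
  · rintro ⟨_, h, rfl, rfl⟩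
    exact ⟨rfl, h⟩
  · rintro ⟨rfl, h⟩
    exact ⟨j, h, rfl, rfl⟩

end Partition

/-- The columns of a matrix over a field at which the generators of `I_S` vanish are specializations
of generic columns with suitable span relations. -/
theorem exists_compatible_algHom {t k₂ : ℕ} {S : Set (Col 2 k₂)}
    (hS : noColumn k₂ S) (hT : tCond k₂ S) {K : Type} [Field K] [Algebra ℂ K]
    (c : Col 2 k₂ → Fin t → K)
    (hc : ∀ f ∈ FSset t k₂ t S, aeval (fun q : Fin t × Col 2 k₂ => c q.2 q.1) f = 0) :
    ∃ D : SpanData (Fin k₂), Compatible S D ∧ D.base.card < t - 1 ∧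
      D.base.card + D.extB.card < t ∧ D.base.card + D.extA.card < t ∧
      ∃ g : MvPolynomial (D.Idx t) ℂ →ₐ[ℂ] K, ∀ p i, c p i ∈ g.range := by
  classical
  have key : ∀ {r : ℕ} (a : Fin r → Fin t) (b : Fin r → Col 2 k₂),
      minorPoly t 2 k₂ r a b ∈ FSset t k₂ t S →
        (Matrix.of fun i j => c (b j) (a i)).det = 0 := fun {r} a b h => by
    rw [← hc _ h, minorPoly, AlgHom.map_det]
    congr 1
    ext i j
    simp
  have hzero : ∀ p ∈ S, c p = 0 := fun p hp => by
    ext1 i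
    have := key (fun _ : Fin 1 => i) (fun _ => p) (.inl <| .inl <| .inl <| .inl
      ⟨_, _, Function.injective_of_subsingleton _, Function.injective_of_subsingleton _,
        fun _ => hp, rfl⟩)
    simpa using this
  have hpar : ∀ j, colOK k₂ S j → ∀ i i', c (0, j) i * c (1, j) i' = c (0, j) i' * c (1, j) i :=
    fun j hj i i' => by
    by_cases hi : i = i'
    · rw [hi]
    have := key ![i, i'] ![(0, j), (1, j)] (.inl <| .inl <| .inl <| .inr <|
      Set.mem_biUnion hj ⟨_, _, by simpa [Function.Injective, Fin.forall_fin_two, eq_comm] using hi,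
        by simp [Function.Injective, Fin.forall_fin_two],
        by simp [Fin.forall_fin_two, colSlice], rfl⟩)
    rw [Matrix.det_fin_two] at this
    simp at this
    linear_combination this
  let ε : Fin k₂ → Fin 2 := fun j => if (0, j) ∈ S then 1 else if (1, j) ∈ S then 0 else
    if c (0, j) = 0 then 1 else 0
  let z : Fin k₂ → Fin t → K := fun j => c (ε j, j)
  have hμ : ∀ j, colOK k₂ S j → ∃ y : K, c (ε j + 1, j) = y • z j := fun j hj => by
    by_cases h0 : c (0, j) = 0
    · have : ε j = 1 := by simp [ε, hj 0, hj 1, h0]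
      exact ⟨0, by simp [this, h0]⟩
    · have h1 : ε j = 0 := by simp [ε, hj 0, hj 1, h0]
      obtain ⟨i, hi⟩ := Function.ne_iff.mp h0
      refine ⟨c (1, j) i / c (0, j) i, ?_⟩
      ext1 i'
      simp only [z, h1, Pi.smul_apply, smul_eq_mul]
      have hi' : c (0, j) i ≠ 0 := hi
      field_simp
      simpa [mul_comm] using hpar j hj i i'
  have hε : ∀ j, (ε j, j) ∉ S := fun j => by
    by_cases h0 : (0, j) ∈ S
    · have h1 : ε j = 1 := if_pos h0
      rw [h1]
      refine fun h => hS j fun p hp => ?_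
      obtain ⟨e, j'⟩ := p
      obtain rfl : j' = j := hp
      fin_cases e
      exacts [h0, h]
    · by_cases h1 : (1, j) ∈ S
      · have h2 : ε j = 0 := by simp [ε, h0, h1]
        rwa [h2]
      · rcases (by omega : ε j = 0 ∨ ε j = 1) with h | h <;> rwa [h]
  choose! y hy using hμ
  obtain ⟨U, B, A, hU, hB, hA, hUB, hUA, hBA, hcover⟩ := exists_partition hS
  obtain ⟨D, rfl, rfl, rfl, hb, hb₁, hb₂, hspan⟩ :=
    SpanData.exists_linearIndepOn (K := K) z hUB hUA hBA hcover
  have hD : Compatible S D := ⟨hU, hB, hA⟩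
  have hinj : ∀ {r : ℕ} {b : Fin r → Fin k₂}, Function.Injective b →
      Function.Injective fun i => (ε (b i), b i) := fun h i i' hi =>
    h (congrArg Prod.snd hi)
  have hrow : ∀ (e : Fin 2) j, (e + 1, j) ∈ S → (ε j, j) ∈ rowSlice 2 k₂ e \ S :=
    fun e j hj => by
      refine ⟨?_, hε j⟩
      have h : ε j ≠ e + 1 := fun h => hε j (by rwa [h])
      exact (by omega : ε j = e)
  refine ⟨D, hD, ?_, ?_, ?_, ?_⟩
  · refine card_lt_of_linearIndepOn_of_det_eq_zero z D.base hb fun a b ha hb h => ?_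
    exact key a (fun i => (ε (b i), b i)) (.inl <| .inl <| .inr <| Set.mem_iUnion.mpr
      ⟨hT, a, _, ha, hinj hb, fun i => (hD.mem_U _).mp (D.base_subset (h i)), rfl⟩)
  · rw [← D.card_base_union_extB]
    refine card_lt_of_linearIndepOn_of_det_eq_zero z _ hb₁ fun a b ha hb h => ?_
    refine key a (fun i => (ε (b i), b i)) (.inl <| .inr ⟨a, _, ha, hinj hb, fun i => ?_, rfl⟩)
    rcases Finset.mem_union.mp (h i) with hi | hi
    · exact .inr ((hD.mem_U _).mp (D.base_subset hi))
    · exact .inl (hrow 0 _ ((hD.mem_B _).mp (D.extB_subset hi)))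
  · rw [← D.card_base_union_extA]
    refine card_lt_of_linearIndepOn_of_det_eq_zero z _ hb₂ fun a b ha hb h => ?_
    refine key a (fun i => (ε (b i), b i)) (.inr ⟨a, _, ha, hinj hb, fun i => ?_, rfl⟩)
    rcases Finset.mem_union.mp (h i) with hi | hi
    · exact .inr ((hD.mem_U _).mp (D.base_subset hi))
    · exact .inl (hrow 1 _ ((hD.mem_A _).mp (D.extA_subset hi)))
  · obtain ⟨g, hg, hg'⟩ := D.exists_algHom z hspan y
    refine ⟨g, fun p i => ?_⟩
    by_cases h : p ∈ S
    · rw [hzero p h]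
      exact zero_mem _
    obtain ⟨e, j⟩ := p
    by_cases h1 : e = ε j
    · rw [h1]
      exact hg j i
    have h2 : e = ε j + 1 := by omega
    have hj : colOK k₂ S j := by
      intro e'
      rcases (by omega : e' = e ∨ e' = ε j) with rfl | rfl
      exacts [h, hε j]
    rw [h2, hy j hj]
    exact mul_mem (hg' j ((hD.mem_U j).mpr hj)) (hg j i)

theorem ringKrullDim_le_of_forall_card_idx_le {t k₂ n : ℕ} {S : Set (Col 2 k₂)}
    (hS : noColumn k₂ S) (hT : tCond k₂ S)
    (hn : ∀ D : SpanData (Fin k₂), Compatible S D → D.base.card < t - 1 →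
      D.base.card + D.extB.card < t → D.base.card + D.extA.card < t →
        Fintype.card (D.Idx t) ≤ n) :
    ringKrullDim (MvP t 2 k₂ ⧸ ISIdeal t k₂ t S) ≤ n := by
  refine ringKrullDim_le_of_forall_quotient_prime fun Q hQ => ?_
  let R := MvP t 2 k₂ ⧸ ISIdeal t k₂ t S
  let f : R ⧸ Q →ₐ[ℂ] FractionRing (R ⧸ Q) := IsScalarTower.toAlgHom ℂ _ _
  let φ : MvP t 2 k₂ →ₐ[ℂ] R ⧸ Q := (Ideal.Quotient.mkₐ ℂ Q).comp (Ideal.Quotient.mkₐ ℂ _)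
  have hφ : Function.Surjective φ :=
    (Ideal.Quotient.mkₐ_surjective ℂ Q).comp (Ideal.Quotient.mkₐ_surjective ℂ _)
  have hφ' : (f.comp φ) = aeval fun q : Fin t × Col 2 k₂ => f (φ (X q)) := by
    ext q
    simp
  obtain ⟨D, hD, h0, h1, h2, g, hg⟩ := exists_compatible_algHom hS hT
    (fun p i => f (φ (X (i, p)))) fun a ha => by
      rw [← hφ']
      have : Ideal.Quotient.mk (ISIdeal t k₂ t S) a = 0 :=
        Ideal.Quotient.eq_zero_iff_mem.mpr (Ideal.subset_span ha)
      simp [φ, this]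
  refine (ringKrullDim_le_card_of_range_le f (IsFractionRing.injective _ _) g ?_).trans
    (by exact_mod_cast hn D hD h0 h1 h2)
  rintro _ ⟨x, rfl⟩
  obtain ⟨a, rfl⟩ := hφ x
  change f.comp φ a ∈ g.range
  induction a using MvPolynomial.induction_on with
  | C r => exact ⟨C r, by simp⟩
  | add p q hp hq => rw [map_add]; exact add_mem hp hq
  | mul_X p q hp => rw [map_mul]; exact mul_mem hp (hg q.2 q.1)

/-- for `k₁ = 2`, `d = t`, `2 ≤ t ≤ k₂`, and every minimal nonempty
`S ⊆ [2]×[k₂]`, the Krull dimension of `ℂ[X]/I_S` equals exactly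
`t² + (t−1)k₂ − (t−1)² − 1`. -/
theorem ISIdeal_krullDim_eq
    (d k₂ t : ℕ) (hd : d = t) (ht : 2 ≤ t) (htk : t ≤ k₂)
    (S : Set (Col 2 k₂)) (hS : minimalSubset k₂ t S) (hne : S ≠ ∅) :
    ringKrullDim (MvP d 2 k₂ ⧸ ISIdeal d k₂ t S) =
      ((t ^ 2 + (t - 1) * k₂ - (t - 1) ^ 2 - 1 : ℕ) : WithBot ℕ∞) := by
  subst hd
  obtain ⟨hcol, hu, -, hv, h2⟩ := hS.resolve_left hne
  obtain ⟨U, B, A, hU, hB, hA, hUB, hUA, hBA, hcover⟩ := exists_partition hcol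
  have hcard : ∀ D : SpanData (Fin k₂), Compatible S D → D.U.card + D.B.card + D.A.card = k₂ ∧
      1 ≤ D.A.card ∧ 1 ≤ D.B.card ∧ D.A.card ≤ k₂ - d + 1 ∧ D.B.card ≤ k₂ - d + 1 ∧
        (d = 2 → D.A.card + D.B.card = k₂) := fun D hD => by
    have := D.card_U_add_card_B_add_card_A
    rw [Fintype.card_fin] at this
    rw [uOf, ← hD.card_A, ← hD.card_B] at hu h2
    rw [vOf, ← hD.card_A, ← hD.card_B] at hv h2
    omega
  let D₀ : SpanData (Fin k₂) := ⟨U, B, A, ∅, ∅, ∅, hUB, hUA, hBA, hcover, by simp, by simp, by simp⟩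
  obtain ⟨hk, hA1, hB1, hAle, hBle, h2'⟩ := hcard D₀ ⟨hU, hB, hA⟩
  dsimp only [D₀] at hk hA1 hB1 hAle hBle h2'
  apply le_antisymm
  · have hT : tCond k₂ S := by
      obtain ⟨j, hj⟩ := Finset.card_pos.mp hA1
      obtain ⟨j', hj'⟩ := Finset.card_pos.mp hB1
      refine ⟨⟨j, (hA j).mp hj, ?_⟩, ⟨j', (hB j').mp hj', ?_⟩⟩
      · rw [← hB]
        exact Finset.disjoint_right.mp hBA hj
      · rw [← hA]
        exact Finset.disjoint_left.mp hBA hj'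
    refine ringKrullDim_le_of_forall_card_idx_le hcol hT fun D hD h0 h1 h2 => ?_
    rw [D.card_idx]
    exact param_count_le ht (hcard D hD).1 (Finset.card_le_card D.base_subset) (by omega)
      (by omega) (by omega) (Finset.card_le_card D.extB_subset) (Finset.card_le_card D.extA_subset)
  · obtain ⟨b, hbU, hb⟩ := Finset.exists_subset_card_eq (min_le_left U.card (d - 2))
    obtain ⟨b₁, hb₁B, hb₁⟩ := Finset.exists_subset_card_eq
      (by omega : d - 1 - min U.card (d - 2) ≤ B.card)
    obtain ⟨b₂, hb₂A, hb₂⟩ := Finset.exists_subset_card_eq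
      (by omega : d - 1 - min U.card (d - 2) ≤ A.card)
    let D : SpanData (Fin k₂) := ⟨U, B, A, b, b₁, b₂, hUB, hUA, hBA, hcover, hbU, hb₁B, hb₂A⟩
    have hD : Compatible S D := ⟨hU, hB, hA⟩
    rw [← param_count_eq ht hk htk hb (m := b₁.card) (n := b₂.card) (by omega) (by omega)
      (Finset.card_le_card hb₁B) (Finset.card_le_card hb₂A)]
    refine le_of_eq_of_le ?_ (card_idx_le_ringKrullDim hD hcol (?_ : b.card < d - 1)
      (?_ : b.card + b₁.card < d) (?_ : b.card + b₂.card < d) fun h => ?_)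
    · rw [D.card_idx]
    · omega
    · omega
    · omega
    · have : 0 < U.card := Finset.card_pos.mpr h
      exact Finset.card_pos.mp (by omega : 0 < b.card)

end CI
end
end
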